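/- Let Λ be a finitely aligned k-graph and let 𝓔 ⊆ FE(Λ) be satiated, and suppose the pair (Λ,𝓔) satisfies condition (C): for every vertex v there exists an aperiodic path x ∈ v∂(Λ;𝓔), and for every vertex v and every F ∈ vFE(Λ) \ 𝓔 there exists an aperiodic path x ∈ v∂(Λ;𝓔) \ F∂(Λ;𝓔). Let {t_λ : λ ∈ Λ} be a relative Cuntz-Krieger (Λ;𝓔)-family in a C*-algebra such that t_v ≠ 0 for every vertex v and ∏_{λ∈F}(t_{r(F)} − t_λt_λ*) ≠ 0 for every F ∈ FE(Λ) \ 𝓔. Then for every finitely supported function a : {(λ,μ) ∈ Λ × Λ : s(λ) = s(μ)} → ℂ, we have ‖Σ_{(λ,μ) : d(λ)=d(μ)} a(λ,μ) t_λ t_μ*‖ ≤ ‖Σ_{(λ,μ)} a(λ,μ) t_λ t_μ*‖. -/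

import Mathlib

open scoped ENNReal

attribute [local instance] Classical.propDecidable

/-- Product of `f` over a set `S`, in some arbitrary order (junk value `1` if `S` is
infinite).  Used for products of commuting projections. -/
noncomputable def listProd {ι A : Type*} [Monoid A] (S : Set ι) (f : ι → A) : A :=
  if h : S.Finite then (h.toFinset.toList.map f).prod else 1

/-- A `k`-graph: a countable category `Λ` (whose morphisms are the terms of `Path`, with
vertices identified with the morphisms of degree `0`) together with a degree functor
`d : Λ → ℕ^k` satisfying the factorisation property. -/
structure KGraph (k : ℕ) where
  Path : Type
  countable : Countable Path
  d : Path → Fin k → ℕ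
  r : Path → Path
  s : Path → Path
  comp : Path → Path → Path
  d_r : ∀ lam, d (r lam) = 0
  d_s : ∀ lam, d (s lam) = 0
  r_r : ∀ lam, r (r lam) = r lam
  s_r : ∀ lam, s (r lam) = r lam
  r_s : ∀ lam, r (s lam) = s lam
  s_s : ∀ lam, s (s lam) = s lam
  comp_source : ∀ lam, comp lam (s lam) = lam
  range_comp : ∀ lam, comp (r lam) lam = lam
  r_comp : ∀ lam mu, s lam = r mu → r (comp lam mu) = r lam
  s_comp : ∀ lam mu, s lam = r mu → s (comp lam mu) = s mu
  d_comp : ∀ lam mu, s lam = r mu → d (comp lam mu) = d lam + d mu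
  comp_assoc : ∀ lam mu nu, s lam = r mu → s mu = r nu →
    comp (comp lam mu) nu = comp lam (comp mu nu)
  factor : ∀ lam m n, d lam = m + n →
    ∃! p : Path × Path, s p.1 = r p.2 ∧ d p.1 = m ∧ d p.2 = n ∧ comp p.1 p.2 = lam

namespace KGraph

variable {k : ℕ} (Λ : KGraph k)

/-- Vertices are identified with the paths of degree `0`. -/
def IsVertex (v : Λ.Path) : Prop := Λ.d v = 0

/-- The unique factorisation of `lam` as a product of a path of degree `m` and the
remaining tail (junk value if `¬ m ≤ d lam`). -/
noncomputable def split (lam : Λ.Path) (m : Fin k → ℕ) : Λ.Path × Λ.Path :=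
  if h : m ≤ Λ.d lam then
    (Λ.factor lam m (Λ.d lam - m) (by
      funext i
      exact (Nat.add_sub_cancel' (h i)).symm)).choose
  else (lam, lam)

/-- The segment `λ(m,n)` of the path `λ`: the unique path of degree `n - m` such that
`λ = λ(0,m) λ(m,n) λ(n, d λ)` (meaningful for `m ≤ n ≤ d λ`). -/
noncomputable def seg (lam : Λ.Path) (m n : Fin k → ℕ) : Λ.Path :=
  (Λ.split (Λ.split lam n).1 m).2

/-- `MCE(μ,ν)`: minimal common extensions of `μ` and `ν`. -/
def MCE (mu nu : Λ.Path) : Set Λ.Path :=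
  {lam | Λ.d lam = Λ.d mu ⊔ Λ.d nu ∧ Λ.seg lam 0 (Λ.d mu) = mu ∧ Λ.seg lam 0 (Λ.d nu) = nu}

/-- `Λ^min(μ,ν) = {(α,β) : μα = νβ ∈ MCE(μ,ν)}`. -/
def Lmin (mu nu : Λ.Path) : Set (Λ.Path × Λ.Path) :=
  {p | Λ.s mu = Λ.r p.1 ∧ Λ.s nu = Λ.r p.2 ∧ Λ.comp mu p.1 = Λ.comp nu p.2 ∧
    Λ.comp mu p.1 ∈ Λ.MCE mu nu}

/-- `Ext(μ;E)`: extensions of `μ` with respect to `E`. -/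
def Ext (mu : Λ.Path) (E : Set Λ.Path) : Set Λ.Path :=
  {a | Λ.r a = Λ.s mu ∧ ∃ nu ∈ E, ∃ b, (a, b) ∈ Λ.Lmin mu nu}

/-- `Λ` is finitely aligned if all the sets `MCE(μ,ν)` are finite. -/
def FinitelyAligned : Prop := ∀ mu nu, (Λ.MCE mu nu).Finite

/-- `E ⊆ vΛ` is exhaustive if `Ext(λ;E) ≠ ∅` for all `λ ∈ vΛ`. -/
def Exhaustive (v : Λ.Path) (E : Set Λ.Path) : Prop :=
  ∀ lam, Λ.r lam = v → (Λ.Ext lam E).Nonempty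

/-- `E ∈ vFE(Λ)`: `E ⊆ vΛ \ {v}` is finite and exhaustive (so `r(E) = v`). -/
def FEat (v : Λ.Path) (E : Set Λ.Path) : Prop :=
  Λ.IsVertex v ∧ (∀ lam ∈ E, Λ.r lam = v ∧ lam ≠ v) ∧ E.Finite ∧ Λ.Exhaustive v E

/-- `FE(Λ)`: the finite exhaustive sets. -/
def FE : Set (Set Λ.Path) := {E | ∃ v, Λ.FEat v E}

/-- `λE = {λμ : μ ∈ E, r(μ) = s(λ)}`. -/
def lamSet (lam : Λ.Path) (E : Set Λ.Path) : Set Λ.Path :=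
  {x | ∃ mu ∈ E, Λ.s lam = Λ.r mu ∧ Λ.comp lam mu = x}

/-- `EΛ = {λμ : λ ∈ E, r(μ) = s(λ)}`. -/
def setLam (E : Set Λ.Path) : Set Λ.Path :=
  {x | ∃ lam ∈ E, ∃ mu, Λ.s lam = Λ.r mu ∧ Λ.comp lam mu = x}

/-- `𝓔 ⊆ FE(Λ)` is satiated if it satisfies (S1)--(S4). -/
def Satiated (𝓔 : Set (Set Λ.Path)) : Prop :=
  𝓔 ⊆ Λ.FE ∧
  (∀ G ∈ 𝓔, ∀ E ∈ Λ.FE, G ⊆ E → E ∈ 𝓔) ∧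
  (∀ G ∈ 𝓔, ∀ v, Λ.FEat v G → ∀ mu, Λ.r mu = v → mu ∉ Λ.setLam G → Λ.Ext mu G ∈ 𝓔) ∧
  (∀ G ∈ 𝓔, ∀ n : Λ.Path → Fin k → ℕ, (∀ lam ∈ G, 0 < n lam ∧ n lam ≤ Λ.d lam) →
    ((fun lam => Λ.seg lam 0 (n lam)) '' G) ∈ 𝓔) ∧
  (∀ G ∈ 𝓔, ∀ G' ⊆ G, ∀ Gl : Λ.Path → Set Λ.Path,
    (∀ lam ∈ G', Gl lam ∈ 𝓔 ∧ Λ.FEat (Λ.s lam) (Gl lam)) →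
    ((G \ G') ∪ ⋃ lam ∈ G', Λ.lamSet lam (Gl lam)) ∈ 𝓔)

/-- The satiation `𝓔̄` of `𝓔`: the smallest satiated subset of `FE(Λ)` containing `𝓔`. -/
def satiation (𝓔 : Set (Set Λ.Path)) : Set (Set Λ.Path) :=
  ⋂₀ {F | 𝓔 ⊆ F ∧ Λ.Satiated F}

/-- `ΠE`: the smallest subset of `Λ` containing `E` which is closed under the operation
`(λ,μ,σ) ↦ λ Ext(μ;{σ})` for `λ,μ,σ ∈ ΠE` with `d(λ) = d(μ)`, `s(λ) = s(μ)`. -/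
def PiSet (E : Set Λ.Path) : Set Λ.Path :=
  ⋂₀ {G | E ⊆ G ∧ ∀ lam mu sig, lam ∈ G → mu ∈ G → sig ∈ G →
    Λ.d lam = Λ.d mu → Λ.s lam = Λ.s mu → Λ.lamSet lam (Λ.Ext mu {sig}) ⊆ G}

/-- `Σ₁(𝓔)`: finite sets `F ⊆ r(E)Λ \ Λ⁰` containing some `E ∈ 𝓔`. -/
def Sig1 (𝓔 : Set (Set Λ.Path)) : Set (Set Λ.Path) :=
  {F | ∃ E ∈ 𝓔, ∃ v, Λ.FEat v E ∧ E ⊆ F ∧ F.Finite ∧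
    ∀ lam ∈ F, Λ.r lam = v ∧ ¬ Λ.IsVertex lam}

/-- `Σ₂(𝓔) = {Ext(μ;E) : E ∈ 𝓔, μ ∈ r(E)Λ \ EΛ}`. -/
def Sig2 (𝓔 : Set (Set Λ.Path)) : Set (Set Λ.Path) :=
  {F | ∃ E ∈ 𝓔, ∃ v, Λ.FEat v E ∧ ∃ mu, Λ.r mu = v ∧ mu ∉ Λ.setLam E ∧ F = Λ.Ext mu E}

/-- `Σ₃(𝓔) = {{λ(0,n_λ) : λ ∈ E} : E ∈ 𝓔, 0 < n_λ ≤ d(λ)}`. -/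
def Sig3 (𝓔 : Set (Set Λ.Path)) : Set (Set Λ.Path) :=
  {F | ∃ E ∈ 𝓔, ∃ n : Λ.Path → Fin k → ℕ, (∀ lam ∈ E, 0 < n lam ∧ n lam ≤ Λ.d lam) ∧
    F = (fun lam => Λ.seg lam 0 (n lam)) '' E}

/-- `Σ₄(𝓔) = {(E \ F) ∪ ⋃_{λ ∈ F} λ F_λ : E ∈ 𝓔, F ⊆ E, F_λ ∈ s(λ)𝓔}`. -/
def Sig4 (𝓔 : Set (Set Λ.Path)) : Set (Set Λ.Path) :=
  {G | ∃ E ∈ 𝓔, ∃ F ⊆ E, ∃ Fl : Λ.Path → Set Λ.Path,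
    (∀ lam ∈ F, Fl lam ∈ 𝓔 ∧ Λ.FEat (Λ.s lam) (Fl lam)) ∧
    G = (E \ F) ∪ ⋃ lam ∈ F, Λ.lamSet lam (Fl lam)}

/-- `Σ = Σ₄ ∘ Σ₃ ∘ Σ₂ ∘ Σ₁`. -/
def SigmaStep (𝓔 : Set (Set Λ.Path)) : Set (Set Λ.Path) :=
  Λ.Sig4 (Λ.Sig3 (Λ.Sig2 (Λ.Sig1 𝓔)))

/-- `Σ^∞(𝓔) = ⋃_{n ≥ 1} Σ^n(𝓔)`. -/
def SigmaInf (𝓔 : Set (Set Λ.Path)) : Set (Set Λ.Path) :=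
  ⋃ n : ℕ, (Λ.SigmaStep)^[n + 1] 𝓔

section StarAlgebra

variable {A : Type*} [Ring A] [StarRing A]

/-- The product `∏_{λ ∈ E} (t_v - t_λ t_λ*)` (the factors pairwise commute for any
family satisfying (TCK1)--(TCK3), so the implicit choice of ordering is immaterial). -/
noncomputable def gapProd (t : Λ.Path → A) (v : Λ.Path) (E : Set Λ.Path) : A :=
  listProd E fun lam => t v - t lam * star (t lam)

/-- Conditions (TCK1)--(TCK3) on a family `{t_λ}`. -/
def TCKFamily (t : Λ.Path → A) : Prop :=
  (∀ v, Λ.IsVertex v → star (t v) = t v ∧ t v * t v = t v) ∧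
  (∀ v w, Λ.IsVertex v → Λ.IsVertex w → v ≠ w → t v * t w = 0) ∧
  (∀ lam mu, Λ.s lam = Λ.r mu → t lam * t mu = t (Λ.comp lam mu)) ∧
  (∀ lam mu, star (t lam) * t mu = ∑ᶠ p ∈ Λ.Lmin lam mu, t p.1 * star (t p.2))

/-- A relative Cuntz-Krieger `(Λ;𝓔)`-family: (TCK1)--(TCK3) together with (CK). -/
def RCKFamily (𝓔 : Set (Set Λ.Path)) (t : Λ.Path → A) : Prop :=
  Λ.TCKFamily t ∧ ∀ E ∈ 𝓔, ∀ v, Λ.FEat v E → Λ.gapProd t v E = 0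

/-- `Θ(t)^{ΠE}_{λ,μ} = t_λ (∏_{λν ∈ ΠE, d(ν) > 0} (t_{s(λ)} - t_ν t_ν*)) t_μ*`. -/
noncomputable def Theta (t : Λ.Path → A) (E : Set Λ.Path) (lam mu : Λ.Path) : A :=
  t lam *
    listProd {nu | Λ.s lam = Λ.r nu ∧ ¬ Λ.IsVertex nu ∧ Λ.comp lam nu ∈ Λ.PiSet E}
      (fun nu => t (Λ.s lam) - t nu * star (t nu)) *
    star (t mu)

end StarAlgebra

end KGraph

/-- A graph morphism `x : Ω_{k,m} → Λ`, encoded by its length `m = d(x) ∈ (ℕ∪{∞})^k`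
and its values `x(p,q)` on the morphisms `(p,q)` of `Ω_{k,m}` (with the junk value
`x(0,0)` outside the meaningful domain, so graph morphisms are extensional). -/
structure GMor {k : ℕ} (Λ : KGraph k) where
  len : Fin k → ℕ∞
  seg : (Fin k → ℕ) → (Fin k → ℕ) → Λ.Path
  d_seg : ∀ p q, p ≤ q → (∀ i, (q i : ℕ∞) ≤ len i) → Λ.d (seg p q) = q - p
  r_seg : ∀ p q, p ≤ q → (∀ i, (q i : ℕ∞) ≤ len i) → Λ.r (seg p q) = seg p p
  s_seg : ∀ p q, p ≤ q → (∀ i, (q i : ℕ∞) ≤ len i) → Λ.s (seg p q) = seg q q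
  comp_seg : ∀ p q u, p ≤ q → q ≤ u → (∀ i, (u i : ℕ∞) ≤ len i) →
    Λ.comp (seg p q) (seg q u) = seg p u
  seg_junk : ∀ p q, ¬ (p ≤ q ∧ ∀ i, (q i : ℕ∞) ≤ len i) → seg p q = seg 0 0

namespace GMor

variable {k : ℕ} {Λ : KGraph k}

/-- The range `r(x) = x(0)` of a graph morphism. -/
def range (x : GMor Λ) : Λ.Path := x.seg 0 0

/-- `y = x|_n^{d(x)}`, the restriction of `x` (defined for `n ≤ d(x)`):
`d(y) = d(x) - n` and `y(p,q) = x(n+p, n+q)`. -/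
def IsRestriction (y x : GMor Λ) (n : Fin k → ℕ) : Prop :=
  (∀ i, y.len i = x.len i - (n i : ℕ∞)) ∧
  ∀ p q, p ≤ q → (∀ i, (q i : ℕ∞) ≤ y.len i) → y.seg p q = x.seg (n + p) (n + q)

/-- `y = λx`, the extension of `x` by `λ ∈ Λ r(x)`: `d(y) = d(λ) + d(x)`,
`y(0, d(λ)) = λ` and `y(d(λ), d(λ)+n) = x(0,n)` for `n ≤ d(x)`. -/
def IsExtension (y : GMor Λ) (lam : Λ.Path) (x : GMor Λ) : Prop :=
  (∀ i, y.len i = (Λ.d lam i : ℕ∞) + x.len i) ∧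
  y.seg 0 (Λ.d lam) = lam ∧
  ∀ n : Fin k → ℕ, (∀ i, (n i : ℕ∞) ≤ x.len i) →
    y.seg (Λ.d lam) (Λ.d lam + n) = x.seg 0 n

/-- `x ∈ FΛ^∞`: `x` has an initial segment belonging to `F`. -/
def HasInit (x : GMor Λ) (F : Set Λ.Path) : Prop :=
  ∃ lam ∈ F, (∀ i, (Λ.d lam i : ℕ∞) ≤ x.len i) ∧ x.seg 0 (Λ.d lam) = lam

/-- `z` restricts to `x` on `Ω_{k, d(x)}`. -/
def Agrees (z x : GMor Λ) : Prop :=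
  ∀ p q, p ≤ q → (∀ i, (q i : ℕ∞) ≤ x.len i) → z.seg p q = x.seg p q

/-- `z ∈ MCE(x,y)` for graph morphisms `x, y`. -/
def IsMCE (z x y : GMor Λ) : Prop :=
  (∀ i, z.len i = max (x.len i) (y.len i)) ∧ z.Agrees x ∧ z.Agrees y

/-- `x` is aperiodic: for distinct `λ, μ ∈ Λ r(x)`, `MCE(λx, μx) = ∅`. -/
def Aperiodic (x : GMor Λ) : Prop :=
  ∀ lam mu : Λ.Path, lam ≠ mu → Λ.s lam = x.range → Λ.s mu = x.range →
    ∀ lx mx : GMor Λ, lx.IsExtension lam x → mx.IsExtension mu x →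
      ∀ z : GMor Λ, ¬ z.IsMCE lx mx

end GMor

namespace KGraph

variable {k : ℕ} (Λ : KGraph k)

/-- `x ∈ ∂(Λ;𝓔)`: an `𝓔`-compatible boundary path. -/
def IsBdry (𝓔 : Set (Set Λ.Path)) (x : GMor Λ) : Prop :=
  ∀ n : Fin k → ℕ, (∀ i, (n i : ℕ∞) ≤ x.len i) →
    ∀ E ∈ 𝓔, Λ.FEat (x.seg n n) E →
      ∃ lam ∈ E, (∀ i, ((n + Λ.d lam) i : ℕ∞) ≤ x.len i) ∧ x.seg n (n + Λ.d lam) = lam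

/-- Condition (C): aperiodic `𝓔`-compatible boundary paths out of every vertex, and
avoiding any given `F ∈ vFE(Λ) \ 𝓔`. -/
def CondC (𝓔 : Set (Set Λ.Path)) : Prop :=
  (∀ v, Λ.IsVertex v → ∃ x : GMor Λ, Λ.IsBdry 𝓔 x ∧ x.range = v ∧ x.Aperiodic) ∧
  (∀ v F, Λ.FEat v F → F ∉ 𝓔 →
    ∃ x : GMor Λ, Λ.IsBdry 𝓔 x ∧ x.range = v ∧ ¬ x.HasInit F ∧ x.Aperiodic)

end KGraph

namespace KGraph

variable {k : ℕ} {Λ : KGraph k}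

section Basic

theorem IsVertex.r_eq_and_s_eq {v : Λ.Path} (hv : Λ.IsVertex v) : Λ.r v = v ∧ Λ.s v = v := by
  have h := (Λ.factor v 0 0 (by rw [hv, add_zero])).unique
    (y₁ := (Λ.r v, v)) (y₂ := (v, Λ.s v))
    ⟨Λ.s_r v, Λ.d_r v, hv, Λ.range_comp v⟩ ⟨(Λ.r_s v).symm, hv, Λ.d_s v, Λ.comp_source v⟩
  rw [Prod.mk.injEq] at h
  exact ⟨h.1, h.2.symm⟩

theorem IsVertex.r_eq {v : Λ.Path} (hv : Λ.IsVertex v) : Λ.r v = v := hv.r_eq_and_s_eq.1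

theorem IsVertex.s_eq {v : Λ.Path} (hv : Λ.IsVertex v) : Λ.s v = v := hv.r_eq_and_s_eq.2

theorem isVertex_r (lam : Λ.Path) : Λ.IsVertex (Λ.r lam) := Λ.d_r lam

theorem isVertex_s (lam : Λ.Path) : Λ.IsVertex (Λ.s lam) := Λ.d_s lam

theorem comp_inj {mu nu alpha beta : Λ.Path} (h₁ : Λ.s mu = Λ.r alpha) (h₂ : Λ.s nu = Λ.r beta)
    (h : Λ.comp mu alpha = Λ.comp nu beta) (hd : Λ.d mu = Λ.d nu) : mu = nu ∧ alpha = beta := by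
  have hd' : Λ.d alpha = Λ.d beta := by
    have e := Λ.d_comp mu alpha h₁
    rw [h, Λ.d_comp nu beta h₂, hd] at e
    exact (add_left_cancel e).symm
  have h' := (Λ.factor (Λ.comp mu alpha) _ _ (Λ.d_comp mu alpha h₁)).unique
    (y₁ := (mu, alpha)) (y₂ := (nu, beta)) ⟨h₁, rfl, rfl, rfl⟩ ⟨h₂, hd.symm, hd'.symm, h.symm⟩
  rwa [Prod.mk.injEq] at h'

/-- `mu` is an initial segment of `kap`. -/
def Pre (mu kap : Λ.Path) : Prop := ∃ alpha, Λ.s mu = Λ.r alpha ∧ Λ.comp mu alpha = kap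

theorem exists_pre {kap : Λ.Path} {m : Fin k → ℕ} (h : m ≤ Λ.d kap) :
    ∃ mu, Pre mu kap ∧ Λ.d mu = m := by
  obtain ⟨p, ⟨h₁, h₂, -, h₄⟩, -⟩ := Λ.factor kap m (Λ.d kap - m) (by
    funext i
    exact (Nat.add_sub_cancel' (h i)).symm)
  exact ⟨p.1, ⟨p.2, h₁, h₄⟩, h₂⟩

theorem Pre.refl (mu : Λ.Path) : Pre mu mu := ⟨Λ.s mu, (Λ.r_s mu).symm, Λ.comp_source mu⟩

theorem pre_comp {mu alpha : Λ.Path} (h : Λ.s mu = Λ.r alpha) : Pre mu (Λ.comp mu alpha) :=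
  ⟨alpha, h, rfl⟩

theorem Pre.trans {mu nu kap : Λ.Path} (h₁ : Pre mu nu) (h₂ : Pre nu kap) : Pre mu kap := by
  obtain ⟨a, ha, rfl⟩ := h₁
  obtain ⟨b, hb, rfl⟩ := h₂
  rw [Λ.s_comp _ _ ha] at hb
  exact ⟨Λ.comp a b, by rw [Λ.r_comp _ _ hb, ha], (Λ.comp_assoc _ _ _ ha hb).symm⟩

theorem Pre.d_le {mu kap : Λ.Path} (h : Pre mu kap) : Λ.d mu ≤ Λ.d kap := by
  obtain ⟨a, ha, rfl⟩ := h
  rw [Λ.d_comp _ _ ha]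
  exact le_self_add

theorem Pre.eq_of_d_eq {mu nu kap : Λ.Path} (h₁ : Pre mu kap) (h₂ : Pre nu kap)
    (h : Λ.d mu = Λ.d nu) : mu = nu := by
  obtain ⟨a, ha, rfl⟩ := h₁
  obtain ⟨b, hb, h'⟩ := h₂
  exact (comp_inj ha hb h'.symm h).1

theorem Pre.of_d_le {mu nu kap : Λ.Path} (h₁ : Pre mu kap) (h₂ : Pre nu kap)
    (h : Λ.d mu ≤ Λ.d nu) : Pre mu nu := by
  obtain ⟨mu', h₃, h₄⟩ := exists_pre h
  rwa [h₁.eq_of_d_eq (h₃.trans h₂) h₄.symm]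

theorem Pre.comp_left {lam mu nu : Λ.Path} (h : Pre mu nu) (hs : Λ.s lam = Λ.r mu) :
    Pre (Λ.comp lam mu) (Λ.comp lam nu) := by
  obtain ⟨a, ha, rfl⟩ := h
  exact ⟨a, by rw [Λ.s_comp _ _ hs, ha], Λ.comp_assoc _ _ _ hs ha⟩

theorem split_spec {kap : Λ.Path} {m : Fin k → ℕ} (h : m ≤ Λ.d kap) :
    Λ.s (Λ.split kap m).1 = Λ.r (Λ.split kap m).2 ∧ Λ.d (Λ.split kap m).1 = m ∧
      Λ.d (Λ.split kap m).2 = Λ.d kap - m ∧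
      Λ.comp (Λ.split kap m).1 (Λ.split kap m).2 = kap := by
  rw [split, dif_pos h]
  exact (Λ.factor kap m (Λ.d kap - m)
    (funext fun i => (Nat.add_sub_cancel' (h i)).symm)).choose_spec.1

theorem seg_zero (kap : Λ.Path) (n : Fin k → ℕ) :
    Λ.seg kap 0 n = (Λ.split kap n).1 := by
  have h₂ := split_spec (kap := (Λ.split kap n).1) (m := 0) (zero_le)
  have e : Λ.r (Λ.split (Λ.split kap n).1 0).2 = (Λ.split (Λ.split kap n).1 0).1 := by
    rw [← h₂.1, IsVertex.s_eq h₂.2.1]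
  have h₃ := h₂.2.2.2
  rw [← e, Λ.range_comp] at h₃
  exact h₃

theorem pre_seg_zero {kap : Λ.Path} {n : Fin k → ℕ} (h : n ≤ Λ.d kap) :
    Pre (Λ.seg kap 0 n) kap := by
  rw [seg_zero]
  exact ⟨_, (split_spec h).1, (split_spec h).2.2.2⟩

theorem d_seg_zero {kap : Λ.Path} {n : Fin k → ℕ} (h : n ≤ Λ.d kap) :
    Λ.d (Λ.seg kap 0 n) = n := by
  rw [seg_zero]
  exact (split_spec h).2.1

theorem Pre.seg_eq {mu kap : Λ.Path} (h : Pre mu kap) : Λ.seg kap 0 (Λ.d mu) = mu :=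
  (pre_seg_zero h.d_le).eq_of_d_eq h (d_seg_zero h.d_le)

theorem mem_MCE {mu nu kap : Λ.Path} :
    kap ∈ Λ.MCE mu nu ↔ Λ.d kap = Λ.d mu ⊔ Λ.d nu ∧ Pre mu kap ∧ Pre nu kap := by
  constructor
  · rintro ⟨h₁, h₂, h₃⟩
    refine ⟨h₁, ?_, ?_⟩
    · conv_lhs => rw [← h₂]
      exact pre_seg_zero (h₁ ▸ le_sup_left)
    · conv_lhs => rw [← h₃]
      exact pre_seg_zero (h₁ ▸ le_sup_right)
  · rintro ⟨h₁, h₂, h₃⟩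
    exact ⟨h₁, h₂.seg_eq, h₃.seg_eq⟩

theorem exists_MCE_of_pre {mu nu kap : Λ.Path} (h₁ : Pre mu kap) (h₂ : Pre nu kap) :
    ∃ lam ∈ Λ.MCE mu nu, Pre lam kap := by
  obtain ⟨lam, h₃, h₄⟩ := exists_pre (sup_le h₁.d_le h₂.d_le)
  exact ⟨lam, mem_MCE.2 ⟨h₄, h₁.of_d_le h₃ (h₄ ▸ le_sup_left), h₂.of_d_le h₃ (h₄ ▸ le_sup_right)⟩,
    h₃⟩

theorem finite_Lmin (hΛ : Λ.FinitelyAligned) (mu nu : Λ.Path) : (Λ.Lmin mu nu).Finite := by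
  refine Set.Finite.of_finite_image (f := fun p => Λ.comp mu p.1)
    ((hΛ mu nu).subset ?_) ?_
  · rintro _ ⟨p, hp, rfl⟩
    exact hp.2.2.2
  · rintro ⟨a, b⟩ ⟨h₁, h₂, h₃, -⟩ ⟨a', b'⟩ ⟨h₁', h₂', h₃', -⟩ h
    have h : Λ.comp mu a = Λ.comp mu a' := h
    have e₁ := (comp_inj h₁ h₁' h rfl).2
    have e₂ := (comp_inj h₂ h₂' (h₃.symm.trans (h.trans h₃')) rfl).2
    dsimp only at e₁ e₂
    rw [e₁, e₂]

end Basic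

section Closure

/-- A set of paths is closed if it contains the minimal common extensions of its elements, and
if initial segments of its elements may be exchanged for elements with the same degree and
source. -/
structure IsClosedSet (G : Set Λ.Path) : Prop where
  mce : ∀ lam ∈ G, ∀ mu ∈ G, Λ.MCE lam mu ⊆ G
  swap : ∀ lam ∈ G, ∀ mu ∈ G, ∀ alpha, Λ.d lam = Λ.d mu → Λ.s lam = Λ.s mu →
    Λ.s mu = Λ.r alpha → Λ.comp mu alpha ∈ G → Λ.comp lam alpha ∈ G

theorem finite_final_segments (kap : Λ.Path) :
    {alpha | ∃ mu, Λ.s mu = Λ.r alpha ∧ Λ.comp mu alpha = kap}.Finite := by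
  refine ((Set.finite_Iic (Λ.d kap)).image fun m => (Λ.split kap m).2).subset ?_
  rintro alpha ⟨mu, h₁, rfl⟩
  have hle : Λ.d mu ≤ Λ.d (Λ.comp mu alpha) := (pre_comp h₁).d_le
  exact ⟨Λ.d mu, hle, (comp_inj (split_spec hle).1 h₁ (split_spec hle).2.2.2
    (split_spec hle).2.1).2⟩

theorem exists_finite_closed_below (hΛ : Λ.FinitelyAligned) {E : Set Λ.Path} (hE : E.Finite)
    {N : Fin k → ℕ} (hN : ∀ lam ∈ E, Λ.d lam ≤ N) (j : ℕ) :
    ∃ G : Set Λ.Path, G.Finite ∧ (∀ lam ∈ G, Λ.d lam ≤ N ∧ ∑ i, Λ.d lam i < j) ∧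
      (∀ lam ∈ E, ∑ i, Λ.d lam i < j → lam ∈ G) ∧
      (∀ lam ∈ G, ∀ mu ∈ G, ∀ kap ∈ Λ.MCE lam mu, ∑ i, Λ.d kap i < j → kap ∈ G) ∧
      (∀ lam ∈ G, ∀ mu ∈ G, ∀ alpha, Λ.d lam = Λ.d mu → Λ.s lam = Λ.s mu →
        Λ.s mu = Λ.r alpha → Λ.comp mu alpha ∈ G → Λ.comp lam alpha ∈ G) := by
  induction j with
  | zero => exact ⟨∅, Set.finite_empty, by simp, by simp, by simp, by simp⟩
  | succ j ih =>
    obtain ⟨G, hfin, hdeg, hEG, hmce, hswap⟩ := ih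
    set B : Set Λ.Path := {kap | (kap ∈ E ∨ ∃ lam ∈ G, ∃ mu ∈ G, kap ∈ Λ.MCE lam mu) ∧
      ∑ i, Λ.d kap i = j} with hB
    have hBfin : B.Finite := by
      have : (E ∪ ⋃ lam ∈ G, ⋃ mu ∈ G, Λ.MCE lam mu).Finite :=
        hE.union (hfin.biUnion fun lam _ => hfin.biUnion fun mu _ => hΛ lam mu)
      refine this.subset ?_
      rintro kap ⟨h | ⟨lam, hl, mu, hm, h⟩, -⟩
      · exact Or.inl h
      · exact Or.inr (Set.mem_biUnion hl (Set.mem_biUnion hm h))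
    have hBN : ∀ kap ∈ B, Λ.d kap ≤ N := by
      rintro kap ⟨h | ⟨lam, hl, mu, hm, h⟩, -⟩
      · exact hN _ h
      · rw [h.1]
        exact sup_le (hdeg _ hl).1 (hdeg _ hm).1
    set R : Set Λ.Path := ⋃ kap ∈ B, {alpha | ∃ mu, Λ.s mu = Λ.r alpha ∧ Λ.comp mu alpha = kap}
      with hR
    have hRfin : R.Finite := hBfin.biUnion fun kap _ => finite_final_segments kap
    have hRmem : ∀ {mu alpha}, Λ.s mu = Λ.r alpha → Λ.comp mu alpha ∈ B → alpha ∈ R :=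
      fun h₁ h₂ => Set.mem_biUnion h₂ ⟨_, h₁, rfl⟩
    have hRtail : ∀ {gam del}, Λ.s gam = Λ.r del → Λ.comp gam del ∈ R → del ∈ R := by
      intro gam del h₁ h₂
      obtain ⟨kap, hk, mu, h₃, h₄⟩ := Set.mem_iUnion₂.1 h₂
      rw [Λ.r_comp _ _ h₁] at h₃
      refine hRmem (mu := Λ.comp mu gam) (by rw [Λ.s_comp _ _ h₃, h₁]) ?_
      rwa [Λ.comp_assoc _ _ _ h₃ h₁, h₄]
    set Y : Set Λ.Path := B ∪ {kap | (∃ lam ∈ G, ∃ alpha ∈ R, Λ.s lam = Λ.r alpha ∧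
      Λ.comp lam alpha = kap) ∧ Λ.d kap ≤ N ∧ ∑ i, Λ.d kap i = j} with hY
    have hYfin : Y.Finite := by
      refine hBfin.union (((hfin.prod hRfin).image fun p => Λ.comp p.1 p.2).subset ?_)
      rintro kap ⟨⟨lam, hl, alpha, ha, -, h⟩, -⟩
      exact ⟨(lam, alpha), ⟨hl, ha⟩, h⟩
    have hYdeg : ∀ kap ∈ Y, Λ.d kap ≤ N ∧ ∑ i, Λ.d kap i = j := by
      rintro kap (h | h)
      · exact ⟨hBN _ h, h.2⟩
      · exact h.2
    have hpre : ∀ {mu kap}, Pre mu kap → ∑ i, Λ.d kap i ≤ ∑ i, Λ.d mu i → mu = kap := by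
      intro mu kap h hs
      refine h.eq_of_d_eq (Pre.refl _) ?_
      have h₁ : ∀ i ∈ Finset.univ, Λ.d mu i ≤ Λ.d kap i := fun i _ => h.d_le i
      have h₂ := (Finset.sum_eq_sum_iff_of_le h₁).1 (le_antisymm (Finset.sum_le_sum h₁) hs)
      exact funext fun i => h₂ i (Finset.mem_univ i)
    have hltG : ∀ {lam}, lam ∈ G ∪ Y → ∑ i, Λ.d lam i < j → lam ∈ G := by
      rintro lam (h | h) hlt
      · exact h
      · exact absurd (hYdeg _ h).2 hlt.ne
    have hle : ∀ {lam}, lam ∈ G ∪ Y → ∑ i, Λ.d lam i ≤ j := by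
      rintro lam (h | h)
      · exact (hdeg _ h).2.le
      · exact (hYdeg _ h).2.le
    have hsum : ∀ {mu kap}, Pre mu kap → ∑ i, Λ.d mu i ≤ ∑ i, Λ.d kap i :=
      fun h => Finset.sum_le_sum fun i _ => h.d_le i
    refine ⟨G ∪ Y, hfin.union hYfin, ?_, ?_, ?_, ?_⟩
    · rintro lam (h | h)
      · exact ⟨(hdeg _ h).1, (hdeg _ h).2.trans (Nat.lt_succ_self j)⟩
      · exact ⟨(hYdeg _ h).1, by rw [(hYdeg _ h).2]; exact Nat.lt_succ_self j⟩
    · intro lam hl hlt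
      rcases Nat.lt_succ_iff_lt_or_eq.1 hlt with h | h
      · exact Or.inl (hEG _ hl h)
      · exact Or.inr (Or.inl ⟨Or.inl hl, h⟩)
    · intro lam hl mu hm kap hk hlt
      have hk' := mem_MCE.1 hk
      by_cases h₁ : ∑ i, Λ.d lam i < j
      · by_cases h₂ : ∑ i, Λ.d mu i < j
        · rcases Nat.lt_succ_iff_lt_or_eq.1 hlt with h | h
          · exact Or.inl (hmce _ (hltG hl h₁) _ (hltG hm h₂) _ hk h)
          · exact Or.inr (Or.inl ⟨Or.inr ⟨_, hltG hl h₁, _, hltG hm h₂, hk⟩, h⟩)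
        · rwa [← hpre hk'.2.2 (by omega)]
      · rwa [← hpre hk'.2.1 (by omega)]
    · intro lam hl mu hm alpha hd hs hsr hma
      have hsr' : Λ.s lam = Λ.r alpha := hs.trans hsr
      have hdd : Λ.d (Λ.comp lam alpha) = Λ.d (Λ.comp mu alpha) := by
        rw [Λ.d_comp _ _ hsr, Λ.d_comp _ _ hsr', hd]
      rcases hma with hma | hma
      · have hlt := (hdeg _ hma).2
        have hmu : ∑ i, Λ.d mu i < j := (hsum (pre_comp hsr)).trans_lt hlt
        exact Or.inl (hswap _ (hltG hl (hd ▸ hmu)) _ (hltG hm hmu) _ hd hs hsr hma)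
      · have hj := hYdeg _ hma
        by_cases hmu : ∑ i, Λ.d mu i < j
        · have hmG := hltG hm hmu
          have hlG := hltG hl (hd ▸ hmu)
          have key : ∀ {lam'' del}, lam'' ∈ G → del ∈ R → Λ.s lam'' = Λ.r del →
              Λ.comp lam'' del = Λ.comp lam alpha → Λ.comp lam alpha ∈ G ∪ Y :=
            fun h₁ h₂ h₃ h₄ => Or.inr (Or.inr ⟨⟨_, h₁, _, h₂, h₃, h₄⟩, hdd ▸ hj⟩)
          have hcaseB : Λ.comp mu alpha ∈ B → Λ.comp lam alpha ∈ G ∪ Y :=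
            fun h => key hlG (hRmem hsr h) hsr' rfl
          rcases hma with hma | ⟨⟨lam', hl', alpha', ha', hsa', heq⟩, -⟩
          · exact hcaseB hma
          · obtain ⟨kap, hk, hkpre⟩ := exists_MCE_of_pre (pre_comp hsr) (heq ▸ pre_comp hsa')
            by_cases hkj : ∑ i, Λ.d kap i < j
            · have hkG := hmce _ hmG _ hl' _ hk hkj
              obtain ⟨-, ⟨gam, hg, hg'⟩, ⟨gam', hgp, hgp'⟩⟩ := mem_MCE.1 hk
              obtain ⟨del, hdl, hdl'⟩ := hkpre
              have hsg : Λ.s gam = Λ.r del := by rw [← hdl, ← hg', Λ.s_comp _ _ hg]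
              have hsg' : Λ.s gam' = Λ.r del := by rw [← hdl, ← hgp', Λ.s_comp _ _ hgp]
              have ha : alpha = Λ.comp gam del := by
                refine (comp_inj hsr (by rw [hg, Λ.r_comp _ _ hsg]) ?_ rfl).2
                rw [← Λ.comp_assoc _ _ _ hg hsg, hg', hdl']
              have hap : alpha' = Λ.comp gam' del := by
                refine (comp_inj hsa' (by rw [hgp, Λ.r_comp _ _ hsg']) ?_ rfl).2
                rw [← Λ.comp_assoc _ _ _ hgp hsg', hgp', hdl', heq]
              have hlg : Λ.s lam = Λ.r gam := hs.trans hg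
              refine key (hswap _ hlG _ hmG gam hd hs hg (hg' ▸ hkG))
                (hRtail hsg' (hap ▸ ha')) (by rw [Λ.s_comp _ _ hlg, hsg]) ?_
              rw [Λ.comp_assoc _ _ _ hlg hsg, ha]
            · have : kap = Λ.comp mu alpha := hpre hkpre (by omega)
              refine hcaseB (this ▸ ⟨Or.inr ⟨_, hmG, _, hl', hk⟩, ?_⟩)
              rw [this]
              exact hj.2
        · have hml : mu = Λ.comp mu alpha := hpre (pre_comp hsr) (by omega)
          have hal : Λ.d alpha = 0 := by
            have := Λ.d_comp _ _ hsr
            rw [← hml] at this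
            exact left_eq_add.1 this
          have : alpha = Λ.s lam := by rw [hsr', IsVertex.r_eq hal]
          rwa [this, Λ.comp_source]

theorem exists_finite_closed (hΛ : Λ.FinitelyAligned) {E : Set Λ.Path} (hE : E.Finite) :
    ∃ G : Set Λ.Path, G.Finite ∧ E ⊆ G ∧ IsClosedSet G := by
  obtain ⟨N, hN⟩ : ∃ N : Fin k → ℕ, ∀ lam ∈ E, Λ.d lam ≤ N := by
    obtain ⟨N, hN⟩ := (hE.image Λ.d).bddAbove
    exact ⟨N, fun lam hl => hN ⟨lam, hl, rfl⟩⟩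
  obtain ⟨G, h₁, h₂, h₃, h₄, h₅⟩ := exists_finite_closed_below hΛ hE hN (∑ i, N i + 1)
  have hlt : ∀ {lam : Λ.Path}, Λ.d lam ≤ N → ∑ i, Λ.d lam i < ∑ i, N i + 1 :=
    fun h => Nat.lt_succ_of_le (Finset.sum_le_sum fun i _ => h i)
  refine ⟨G, h₁, fun lam hl => h₃ _ hl (hlt (hN _ hl)), ⟨fun lam hl mu hm kap hk => ?_, h₅⟩⟩
  refine h₄ _ hl _ hm _ hk (hlt ?_)
  rw [hk.1]
  exact sup_le (h₂ _ hl).1 (h₂ _ hm).1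

end Closure

end KGraph

namespace GMor

variable {k : ℕ} {Λ : KGraph k}

open KGraph

theorem le_len_zero (L : Fin k → ℕ∞) : ∀ i, (((0 : Fin k → ℕ) i : ℕ) : ℕ∞) ≤ L i := by
  intro i
  simp

theorem le_len_of_le {L : Fin k → ℕ∞} {p q : Fin k → ℕ} (h : p ≤ q)
    (hq : ∀ i, (q i : ℕ∞) ≤ L i) : ∀ i, (p i : ℕ∞) ≤ L i :=
  fun i => le_trans (by exact_mod_cast h i) (hq i)

theorem seg_zero_spec (x : GMor Λ) {p q : Fin k → ℕ} (hpq : p ≤ q)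
    (hq : ∀ i, (q i : ℕ∞) ≤ x.len i) :
    Λ.s (x.seg 0 p) = Λ.r (x.seg p q) ∧ Λ.comp (x.seg 0 p) (x.seg p q) = x.seg 0 q := by
  refine ⟨?_, x.comp_seg 0 p q zero_le hpq hq⟩
  rw [x.s_seg 0 p zero_le (le_len_of_le hpq hq), x.r_seg p q hpq hq]

theorem pre_seg (x : GMor Λ) {p q : Fin k → ℕ} (hpq : p ≤ q)
    (hq : ∀ i, (q i : ℕ∞) ≤ x.len i) : Pre (x.seg 0 p) (x.seg 0 q) :=
  ⟨_, x.seg_zero_spec hpq hq⟩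

theorem d_seg_zero (x : GMor Λ) {q : Fin k → ℕ} (hq : ∀ i, (q i : ℕ∞) ≤ x.len i) :
    Λ.d (x.seg 0 q) = q := by
  rw [x.d_seg 0 q zero_le hq]
  exact tsub_zero q

theorem r_seg_zero (x : GMor Λ) {q : Fin k → ℕ} (hq : ∀ i, (q i : ℕ∞) ≤ x.len i) :
    Λ.r (x.seg 0 q) = x.range := x.r_seg 0 q zero_le hq

theorem exists_of_family (L : Fin k → ℕ∞) (y : (Fin k → ℕ) → Λ.Path)
    (hd : ∀ q, (∀ i, (q i : ℕ∞) ≤ L i) → Λ.d (y q) = q)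
    (hp : ∀ p q, p ≤ q → (∀ i, (q i : ℕ∞) ≤ L i) → Pre (y p) (y q)) :
    ∃ z : GMor Λ, z.len = L ∧ ∀ q, (∀ i, (q i : ℕ∞) ≤ L i) → z.seg 0 q = y q := by
  have key : ∀ p q, p ≤ q → (∀ i, (q i : ℕ∞) ≤ L i) →
      Λ.s (y p) = Λ.r (Λ.split (y q) p).2 ∧ Λ.d (Λ.split (y q) p).2 = q - p ∧
        Λ.comp (y p) (Λ.split (y q) p).2 = y q := by
    intro p q hpq hq
    have hspec := split_spec (kap := y q) (m := p) (by rwa [hd q hq])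
    have e : (Λ.split (y q) p).1 = y p :=
      Pre.eq_of_d_eq ⟨_, hspec.1, hspec.2.2.2⟩ (hp p q hpq hq)
        (by rw [hspec.2.1, hd p (le_len_of_le hpq hq)])
    rw [e] at hspec
    exact ⟨hspec.1, by rw [hspec.2.2.1, hd q hq], hspec.2.2.2⟩
  have hself : ∀ p, (∀ i, (p i : ℕ∞) ≤ L i) → (Λ.split (y p) p).2 = Λ.s (y p) := by
    intro p h
    have hk := key p p le_rfl h
    exact (comp_inj hk.1 (Λ.r_s _).symm (hk.2.2.trans (Λ.comp_source _).symm) rfl).2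
  have hs : ∀ p q, p ≤ q → (∀ i, (q i : ℕ∞) ≤ L i) →
      Λ.s (Λ.split (y q) p).2 = Λ.s (y q) := by
    intro p q hpq hq
    have hk := key p q hpq hq
    rw [← Λ.s_comp _ _ hk.1, hk.2.2]
  let z : GMor Λ :=
    { len := L
      seg := fun p q => if p ≤ q ∧ ∀ i, (q i : ℕ∞) ≤ L i then (Λ.split (y q) p).2 else
        (Λ.split (y 0) 0).2
      d_seg := by
        intro p q hpq hq
        rw [if_pos ⟨hpq, hq⟩]
        exact (key p q hpq hq).2.1
      r_seg := by
        intro p q hpq hq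
        have hp' := le_len_of_le hpq hq
        rw [if_pos ⟨hpq, hq⟩, if_pos ⟨le_rfl, hp'⟩, hself p hp']
        exact (key p q hpq hq).1.symm
      s_seg := by
        intro p q hpq hq
        rw [if_pos ⟨hpq, hq⟩, if_pos ⟨le_rfl, hq⟩, hself q hq, hs p q hpq hq]
      comp_seg := by
        intro p q u hpq hqu hu
        have hq := le_len_of_le hqu hu
        rw [if_pos ⟨hpq, hq⟩, if_pos ⟨hqu, hu⟩, if_pos ⟨hpq.trans hqu, hu⟩]
        have h₁ := key p q hpq hq
        have h₂ := key q u hqu hu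
        have h₃ := key p u (hpq.trans hqu) hu
        have h₄ : Λ.s (Λ.split (y q) p).2 = Λ.r (Λ.split (y u) q).2 := by
          rw [hs p q hpq hq, h₂.1]
        refine (comp_inj (by rw [Λ.r_comp _ _ h₄, h₁.1]) h₃.1 ?_ rfl).2
        rw [← Λ.comp_assoc _ _ _ h₁.1 h₄, h₁.2.2, h₂.2.2, h₃.2.2]
      seg_junk := by
        intro p q h
        rw [if_neg h, if_pos ⟨le_rfl, le_len_zero L⟩] }
  refine ⟨z, rfl, fun q hq => ?_⟩
  have hz : z.seg 0 q = (Λ.split (y q) 0).2 := if_pos ⟨zero_le, hq⟩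
  have hk := key 0 q zero_le hq
  rw [IsVertex.s_eq (hd 0 (le_len_zero L))] at hk
  have hr := Λ.range_comp (Λ.split (y q) 0).2
  rw [← hk.1, hk.2.2] at hr
  exact hz.trans hr.symm

theorem agrees_of_seg_zero {z x : GMor Λ} (hlen : ∀ i, x.len i ≤ z.len i)
    (h : ∀ q, (∀ i, (q i : ℕ∞) ≤ x.len i) → z.seg 0 q = x.seg 0 q) : z.Agrees x := by
  intro p q hpq hq
  have h₁ := x.seg_zero_spec hpq hq
  have h₂ := z.seg_zero_spec hpq fun i => (hq i).trans (hlen i)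
  refine (comp_inj h₂.1 h₁.1 ?_ ?_).2
  · rw [h₁.2, h₂.2, h q hq]
  · rw [h p (le_len_of_le hpq hq)]

theorem exists_isExtension (x : GMor Λ) {lam : Λ.Path} (hlam : Λ.s lam = x.range) :
    ∃ y : GMor Λ, y.IsExtension lam x := by
  have hsub : ∀ q : Fin k → ℕ, (∀ i, (q i : ℕ∞) ≤ Λ.d lam i + x.len i) →
      ∀ i, ((q - Λ.d lam) i : ℕ∞) ≤ x.len i := by
    intro q hq i
    rw [Pi.sub_apply, ENat.natCast_sub]
    exact tsub_le_iff_left.2 (hq i)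
  have hs : ∀ m, (∀ i, (m i : ℕ∞) ≤ x.len i) → Λ.s lam = Λ.r (x.seg 0 m) :=
    fun m hm => by rw [hlam, x.r_seg_zero hm]
  have hle : ∀ q : Fin k → ℕ, (∀ i, (q i : ℕ∞) ≤ Λ.d lam i + x.len i) →
      q ≤ Λ.d (Λ.comp lam (x.seg 0 (q - Λ.d lam))) := by
    intro q hq
    rw [Λ.d_comp _ _ (hs _ (hsub q hq)), x.d_seg_zero (hsub q hq)]
    exact le_add_tsub
  obtain ⟨y, hy, hyseg⟩ := exists_of_family (Λ := Λ) (fun i => Λ.d lam i + x.len i)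
    (fun q => Λ.seg (Λ.comp lam (x.seg 0 (q - Λ.d lam))) 0 q)
    (fun q hq => KGraph.d_seg_zero (hle q hq)) (by
      intro p q hpq hq
      have hp := le_len_of_le hpq hq
      have h₁ : Pre (Λ.seg (Λ.comp lam (x.seg 0 (p - Λ.d lam))) 0 p)
          (Λ.comp lam (x.seg 0 (q - Λ.d lam))) :=
        (pre_seg_zero (hle p hp)).trans
          ((x.pre_seg (tsub_le_tsub_right hpq _) (hsub q hq)).comp_left (hs _ (hsub p hp)))
      refine h₁.of_d_le (pre_seg_zero (hle q hq)) ?_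
      rwa [KGraph.d_seg_zero (hle p hp), KGraph.d_seg_zero (hle q hq)])
  have hadd : ∀ n : Fin k → ℕ, (∀ i, (n i : ℕ∞) ≤ x.len i) →
      ∀ i, ((Λ.d lam + n) i : ℕ∞) ≤ Λ.d lam i + x.len i := by
    intro n hn i
    rw [Pi.add_apply, Nat.cast_add]
    exact add_le_add le_rfl (hn i)
  have hseg : ∀ n : Fin k → ℕ, (∀ i, (n i : ℕ∞) ≤ x.len i) →
      y.seg 0 (Λ.d lam + n) = Λ.comp lam (x.seg 0 n) := by
    intro n hn
    rw [hyseg _ (hadd n hn), add_tsub_cancel_left]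
    have : Λ.d lam + n = Λ.d (Λ.comp lam (x.seg 0 n)) := by
      rw [Λ.d_comp _ _ (hs n hn), x.d_seg_zero hn]
    rw [this]
    exact (Pre.refl _).seg_eq
  have h0 : y.seg 0 (Λ.d lam) = lam := by
    have h := hseg 0 (le_len_zero _)
    have hx : x.seg 0 0 = Λ.s lam := hlam.symm
    rwa [add_zero, hx, Λ.comp_source] at h
  refine ⟨y, fun i => by rw [hy], h0, fun n hn => ?_⟩
  have h := y.seg_zero_spec (p := Λ.d lam) (q := Λ.d lam + n) le_self_add
    (by rw [hy]; exact hadd n hn)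
  rw [h0, hseg n hn] at h
  exact (comp_inj h.1 (hs n hn) h.2 rfl).2

theorem IsExtension.seg_zero {y x : GMor Λ} {lam : Λ.Path} (h : y.IsExtension lam x)
    {n : Fin k → ℕ} (hn : ∀ i, (n i : ℕ∞) ≤ x.len i) :
    (∀ i, ((Λ.d lam + n) i : ℕ∞) ≤ y.len i) ∧
      y.seg 0 (Λ.d lam + n) = Λ.comp lam (x.seg 0 n) := by
  have hadd : ∀ i, ((Λ.d lam + n) i : ℕ∞) ≤ y.len i := by
    intro i
    rw [h.1, Pi.add_apply, Nat.cast_add]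
    exact add_le_add le_rfl (hn i)
  refine ⟨hadd, ?_⟩
  rw [← (y.seg_zero_spec (p := Λ.d lam) (q := Λ.d lam + n) le_self_add hadd).2, h.2.1, h.2.2 n hn]

/-- Truncation of a multi-index `q` at a possibly infinite multi-index `L`. -/
noncomputable def trunc (q : Fin k → ℕ) (L : Fin k → ℕ∞) : Fin k → ℕ :=
  fun i => (min (q i : ℕ∞) (L i)).toNat

theorem coe_trunc (q : Fin k → ℕ) (L : Fin k → ℕ∞) (i : Fin k) :
    (trunc q L i : ℕ∞) = min (q i : ℕ∞) (L i) :=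
  ENat.natCast_toNat (ne_top_of_le_ne_top (ENat.natCast_ne_top (q i)) (min_le_left _ _))

theorem trunc_le (q : Fin k → ℕ) (L : Fin k → ℕ∞) : trunc q L ≤ q := by
  intro i
  have := min_le_left (q i : ℕ∞) (L i)
  rw [← coe_trunc] at this
  exact_mod_cast this

theorem trunc_le_len (q : Fin k → ℕ) (L : Fin k → ℕ∞) : ∀ i, (trunc q L i : ℕ∞) ≤ L i := by
  intro i
  rw [coe_trunc]
  exact min_le_right _ _

/-- The paths of degree `q` which are compatible with the graph morphism `x`. -/
def Compat (x : GMor Λ) (q : Fin k → ℕ) (kap : Λ.Path) : Prop :=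
  ∀ p, p ≤ q → (∀ i, (p i : ℕ∞) ≤ x.len i) → Pre (x.seg 0 p) kap

theorem Compat.pre {x : GMor Λ} {p q : Fin k → ℕ} {mu kap : Λ.Path} (h : x.Compat q kap)
    (hpq : p ≤ q) (hmu : Pre mu kap) (hd : Λ.d mu = p) : x.Compat p mu := by
  intro n hn hx
  refine (h n (hn.trans hpq) hx).of_d_le hmu ?_
  rwa [x.d_seg_zero hx, hd]

open CategoryTheory in
theorem exists_isMCE (hΛ : Λ.FinitelyAligned) {x y : GMor Λ}
    (h : ∀ q : Fin k → ℕ, (∀ i, (q i : ℕ∞) ≤ max (x.len i) (y.len i)) →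
      ∃ kap, Λ.d kap = q ∧ x.Compat q kap ∧ y.Compat q kap) :
    ∃ z : GMor Λ, z.IsMCE x y := by
  let J := {q : Fin k → ℕ // ∀ i, (q i : ℕ∞) ≤ max (x.len i) (y.len i)}
  let S : J → Set Λ.Path := fun q => {kap | Λ.d kap = q.1 ∧ x.Compat q.1 kap ∧ y.Compat q.1 kap}
  have hdir : IsDirectedOrder J := ⟨fun p q => ⟨⟨p.1 ⊔ q.1, fun i => by
    rw [Pi.sup_apply]
    rcases le_total (p.1 i) (q.1 i) with h | h
    · rw [sup_eq_right.2 h]; exact q.2 i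
    · rw [sup_eq_left.2 h]; exact p.2 i⟩,
    (le_sup_left : p.1 ≤ p.1 ⊔ q.1), (le_sup_right : q.1 ≤ p.1 ⊔ q.1)⟩⟩
  have hmap : ∀ {p q : J}, p ≤ q → ∀ kap ∈ S q, Λ.seg kap 0 p.1 ∈ S p := by
    intro p q hpq kap hk
    have hle : p.1 ≤ Λ.d kap := by rw [hk.1]; exact hpq
    exact ⟨KGraph.d_seg_zero hle,
      hk.2.1.pre hpq (pre_seg_zero hle) (KGraph.d_seg_zero hle),
      hk.2.2.pre hpq (pre_seg_zero hle) (KGraph.d_seg_zero hle)⟩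
  let F : Jᵒᵖ ⥤ Type :=
    { obj := fun q => S q.unop
      map := fun f => ↾ fun kap => ⟨Λ.seg kap.1 0 _, hmap (leOfHom f.unop) kap.1 kap.2⟩
      map_id := by
        intro q
        ext kap
        have hk : Λ.d kap.1 = q.unop.1 := kap.2.1
        have e := (Pre.refl kap.1).seg_eq
        rw [hk] at e
        exact e
      map_comp := by
        intro p q u f g
        ext kap
        have hk : Λ.d kap.1 = p.unop.1 := kap.2.1
        have hqp : q.unop.1 ≤ p.unop.1 := leOfHom f.unop
        have huq : u.unop.1 ≤ q.unop.1 := leOfHom g.unop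
        have h₁ : q.unop.1 ≤ Λ.d kap.1 := hk ▸ hqp
        have h₂ : u.unop.1 ≤ Λ.d kap.1 := huq.trans h₁
        have h₃ : u.unop.1 ≤ Λ.d (Λ.seg kap.1 0 q.unop.1) := by rwa [KGraph.d_seg_zero h₁]
        refine (pre_seg_zero h₂).eq_of_d_eq ((pre_seg_zero h₃).trans (pre_seg_zero h₁)) ?_
        exact (KGraph.d_seg_zero h₂).trans (KGraph.d_seg_zero h₃).symm }
  have hfin : ∀ q : J, (S q).Finite := by
    intro q
    refine (hΛ (x.seg 0 (trunc q.1 x.len)) (y.seg 0 (trunc q.1 y.len))).subset fun kap hk => ?_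
    refine mem_MCE.2 ⟨?_, hk.2.1 _ (trunc_le _ _) (trunc_le_len _ _),
      hk.2.2 _ (trunc_le _ _) (trunc_le_len _ _)⟩
    rw [hk.1, x.d_seg_zero (trunc_le_len _ _), y.d_seg_zero (trunc_le_len _ _)]
    funext i
    have : (q.1 i : ℕ∞) = max (trunc q.1 x.len i : ℕ∞) (trunc q.1 y.len i) := by
      rw [coe_trunc, coe_trunc, ← min_max_distrib_left, min_eq_left (q.2 i)]
    rw [← (Nat.mono_cast (α := ℕ∞)).map_max] at this
    exact_mod_cast this
  have : ∀ q : Jᵒᵖ, Finite (F.obj q) := fun q => (hfin q.unop).to_subtype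
  have : ∀ q : Jᵒᵖ, Nonempty (F.obj q) := fun q => by
    obtain ⟨kap, hk⟩ := h q.unop.1 q.unop.2
    exact ⟨⟨kap, hk⟩⟩
  obtain ⟨u, hu⟩ := nonempty_sections_of_finite_inverse_system F
  let w : (Fin k → ℕ) → Λ.Path := fun q =>
    if hq : ∀ i, (q i : ℕ∞) ≤ max (x.len i) (y.len i) then (u (Opposite.op ⟨q, hq⟩)).1 else
      x.range
  have hw : ∀ q (hq : ∀ i, (q i : ℕ∞) ≤ max (x.len i) (y.len i)), w q ∈ S ⟨q, hq⟩ := by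
    intro q hq
    have : w q = (u (Opposite.op ⟨q, hq⟩)).1 := dif_pos hq
    rw [this]
    exact (u (Opposite.op ⟨q, hq⟩)).2
  obtain ⟨z, hz, hzseg⟩ := exists_of_family (fun i => max (x.len i) (y.len i)) w
    (fun q hq => (hw q hq).1) (by
      intro p q hpq hq
      have hp := le_len_of_le hpq hq
      have e₁ : w q = (u (Opposite.op ⟨q, hq⟩)).1 := dif_pos hq
      have e₂ : w p = (u (Opposite.op ⟨p, hp⟩)).1 := dif_pos hp
      have hle : (⟨p, hp⟩ : J) ≤ ⟨q, hq⟩ := hpq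
      have e₃ := congrArg Subtype.val (hu (homOfLE hle).op)
      have e₄ : Λ.seg (w q) 0 p = w p := by
        rw [e₁, e₂]
        exact e₃
      rw [← e₄]
      exact pre_seg_zero (by rwa [(hw q hq).1]))
  refine ⟨z, fun i => by rw [hz], agrees_of_seg_zero (fun i => ?_) fun q hq => ?_,
    agrees_of_seg_zero (fun i => ?_) fun q hq => ?_⟩
  · rw [hz]; exact le_max_left _ _
  · have hq' : ∀ i, (q i : ℕ∞) ≤ max (x.len i) (y.len i) := fun i => (hq i).trans (le_max_left _ _)
    rw [hzseg q hq']
    exact (((hw q hq').2.1 q le_rfl hq).eq_of_d_eq (Pre.refl _)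
      (by rw [x.d_seg_zero hq, (hw q hq').1])).symm
  · rw [hz]; exact le_max_right _ _
  · have hq' : ∀ i, (q i : ℕ∞) ≤ max (x.len i) (y.len i) := fun i => (hq i).trans (le_max_right _ _)
    rw [hzseg q hq']
    exact (((hw q hq').2.2 q le_rfl hq).eq_of_d_eq (Pre.refl _)
      (by rw [y.d_seg_zero hq, (hw q hq').1])).symm

theorem Aperiodic.exists_seg (hΛ : Λ.FinitelyAligned) {x : GMor Λ} (hx : x.Aperiodic)
    {lam mu : Λ.Path} (hne : lam ≠ mu) (hl : Λ.s lam = x.range) (hm : Λ.s mu = x.range) :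
    ∃ m : Fin k → ℕ, (∀ i, (m i : ℕ∞) ≤ x.len i) ∧ ∀ kap,
      ¬ (Pre (Λ.comp lam (x.seg 0 m)) kap ∧ Pre (Λ.comp mu (x.seg 0 m)) kap) := by
  by_contra! hcon
  obtain ⟨lx, hlx⟩ := x.exists_isExtension hl
  obtain ⟨mx, hmx⟩ := x.exists_isExtension hm
  have hcompat : ∀ {nu : Λ.Path} {nx : GMor Λ} {q : Fin k → ℕ} {kap kap' : Λ.Path},
      nx.IsExtension nu x → Pre (Λ.comp nu (x.seg 0 (trunc q x.len))) kap → Pre kap' kap →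
      Λ.d kap' = q → nx.Compat q kap' := by
    intro nu nx q kap kap' hnx h₁ h₂ h₃ p hp hpl
    have hs := hnx.seg_zero (trunc_le_len q x.len)
    have hle : p ≤ Λ.d nu + trunc q x.len := by
      intro i
      have h₄ := hpl i
      rw [hnx.1] at h₄
      have h₅ : (p i : ℕ∞) ≤ Λ.d nu i + (trunc q x.len i : ℕ∞) := by
        rw [coe_trunc]
        rcases le_total (q i : ℕ∞) (x.len i) with h | h
        · rw [min_eq_left h]
          have : (p i : ℕ∞) ≤ q i := by exact_mod_cast hp i
          exact this.trans le_add_self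
        · rwa [min_eq_right h]
      exact_mod_cast h₅
    have h₆ : Pre (nx.seg 0 p) kap := (nx.pre_seg hle hs.1).trans (hs.2 ▸ h₁)
    refine h₆.of_d_le h₂ ?_
    rwa [nx.d_seg_zero hpl, h₃]
  obtain ⟨z, hz⟩ := exists_isMCE hΛ (x := lx) (y := mx) (by
    intro q hq
    obtain ⟨kap, h₁, h₂⟩ := hcon (trunc q x.len) (trunc_le_len _ _)
    have hsx : ∀ {nu : Λ.Path}, Λ.s nu = x.range → Λ.s nu = Λ.r (x.seg 0 (trunc q x.len)) :=
      fun h => by rw [h, x.r_seg_zero (trunc_le_len _ _)]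
    have hle : q ≤ Λ.d kap := by
      intro i
      have h₃ := h₁.d_le i
      have h₄ := h₂.d_le i
      rw [Λ.d_comp _ _ (hsx hl), x.d_seg_zero (trunc_le_len _ _)] at h₃
      rw [Λ.d_comp _ _ (hsx hm), x.d_seg_zero (trunc_le_len _ _)] at h₄
      have h₅ : (q i : ℕ∞) ≤ Λ.d kap i := by
        have h₆ : ((Λ.d lam + trunc q x.len) i : ℕ∞) ≤ Λ.d kap i := by exact_mod_cast h₃
        have h₇ : ((Λ.d mu + trunc q x.len) i : ℕ∞) ≤ Λ.d kap i := by exact_mod_cast h₄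
        rw [Pi.add_apply, Nat.cast_add, coe_trunc] at h₆ h₇
        rcases le_total (q i : ℕ∞) (x.len i) with h | h
        · rw [min_eq_left h] at h₆
          exact le_add_self.trans h₆
        · rw [min_eq_right h] at h₆ h₇
          have := hq i
          rw [hlx.1, hmx.1] at this
          exact this.trans (max_le h₆ h₇)
      exact_mod_cast h₅
    obtain ⟨kap', h₃, h₄⟩ := exists_pre hle
    exact ⟨kap', h₄, hcompat hlx h₁ h₃ h₄, hcompat hmx h₂ h₃ h₄⟩)
  exact hx lam mu hne hl hm lx mx hlx hmx z hz

theorem Aperiodic.exists_seg_of_finite (hΛ : Λ.FinitelyAligned) {x : GMor Λ} (hx : x.Aperiodic)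
    {P : Set (Λ.Path × Λ.Path)} (hP : P.Finite)
    (h : ∀ p ∈ P, p.1 ≠ p.2 ∧ Λ.s p.1 = x.range ∧ Λ.s p.2 = x.range) :
    ∃ m : Fin k → ℕ, (∀ i, (m i : ℕ∞) ≤ x.len i) ∧ ∀ p ∈ P, ∀ kap,
      ¬ (Pre (Λ.comp p.1 (x.seg 0 m)) kap ∧ Pre (Λ.comp p.2 (x.seg 0 m)) kap) := by
  induction P, hP using Set.Finite.induction_on with
  | empty => exact ⟨0, le_len_zero _, by simp⟩
  | insert _ _ ih =>
    rename_i a P _ _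
    obtain ⟨m₁, hm₁, h₁⟩ := ih fun p hp => h p (Or.inr hp)
    obtain ⟨hne, ha₁, ha₂⟩ := h a (Or.inl rfl)
    obtain ⟨m₂, hm₂, h₂⟩ := hx.exists_seg hΛ hne ha₁ ha₂
    have hm : ∀ i, ((m₁ ⊔ m₂) i : ℕ∞) ≤ x.len i := by
      intro i
      rw [Pi.sup_apply]
      rcases le_total (m₁ i) (m₂ i) with h | h
      · rw [sup_eq_right.2 h]; exact hm₂ i
      · rw [sup_eq_left.2 h]; exact hm₁ i
    have hmono : ∀ {nu : Λ.Path} {m : Fin k → ℕ} {kap : Λ.Path}, Λ.s nu = x.range →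
        m ≤ m₁ ⊔ m₂ → Pre (Λ.comp nu (x.seg 0 (m₁ ⊔ m₂))) kap →
        Pre (Λ.comp nu (x.seg 0 m)) kap := fun hs hle hpre =>
      ((x.pre_seg hle hm).comp_left (by rw [hs, x.r_seg_zero (le_len_of_le hle hm)])).trans hpre
    refine ⟨m₁ ⊔ m₂, hm, ?_⟩
    rintro p (rfl | hp) kap ⟨hk₁, hk₂⟩
    · exact h₂ kap ⟨hmono ha₁ le_sup_right hk₁, hmono ha₂ le_sup_right hk₂⟩
    · obtain ⟨-, hp₁, hp₂⟩ := h p (Or.inr hp)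
      exact h₁ p hp kap ⟨hmono hp₁ le_sup_left hk₁, hmono hp₂ le_sup_left hk₂⟩

end GMor

section ListProd

variable {A ι : Type*} [Ring A]

theorem List.isStarProjection_prod [StarRing A] {l : List A} (h : ∀ x ∈ l, IsStarProjection x)
    (hc : ∀ x ∈ l, ∀ y ∈ l, Commute x y) : IsStarProjection l.prod := by
  induction l with
  | nil => simp
  | cons x l ih =>
    have hx := h x List.mem_cons_self
    have hl := ih (fun y hy => h y (List.mem_cons_of_mem _ hy))
      fun y hy z hz => hc y (List.mem_cons_of_mem _ hy) z (List.mem_cons_of_mem _ hz)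
    have hcomm : Commute x l.prod :=
      Commute.list_prod_right _ _ fun y hy =>
        hc x List.mem_cons_self y (List.mem_cons_of_mem _ hy)
    rw [List.prod_cons]
    refine ⟨?_, ?_⟩
    · exact hx.isIdempotentElem.mul_of_commute hcomm hl.isIdempotentElem
    · exact (hx.isSelfAdjoint.commute_iff hl.isSelfAdjoint).1 hcomm

theorem listProd_induction {S : Set ι} {f : ι → A} (P : A → Prop)
    (h : ∀ l : List A, (∀ x, x ∈ l ↔ S.Finite ∧ ∃ i ∈ S, f i = x) → P l.prod) :
    P (listProd S f) := by
  unfold listProd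
  split_ifs with hS
  · exact h _ fun x => by simp [hS]
  · simpa using h [] fun x => by simp [hS]

theorem isStarProjection_listProd [StarRing A] {S : Set ι} {f : ι → A}
    (h : ∀ i ∈ S, IsStarProjection (f i))
    (hc : ∀ i ∈ S, ∀ j ∈ S, Commute (f i) (f j)) : IsStarProjection (listProd S f) := by
  refine listProd_induction _ fun l hl => List.isStarProjection_prod (fun x hx => ?_)
    fun x hx y hy => ?_
  · obtain ⟨-, i, hi, rfl⟩ := (hl x).1 hx
    exact h i hi
  · obtain ⟨-, i, hi, rfl⟩ := (hl x).1 hx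
    obtain ⟨-, j, hj, rfl⟩ := (hl y).1 hy
    exact hc i hi j hj

theorem commute_listProd {S : Set ι} {f : ι → A} {x : A} (h : ∀ i ∈ S, Commute x (f i)) :
    Commute x (listProd S f) := by
  refine listProd_induction _ fun l hl => Commute.list_prod_right _ _ fun y hy => ?_
  obtain ⟨-, i, hi, rfl⟩ := (hl y).1 hy
  exact h i hi

theorem listProd_mul_eq_self {S : Set ι} {f : ι → A} {w : A} (h : ∀ i ∈ S, f i * w = w) :
    listProd S f * w = w := by
  refine listProd_induction (fun p => p * w = w) fun l hl => ?_
  have hl' : ∀ y ∈ l, y * w = w := fun y hy => by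
    obtain ⟨-, i, hi, rfl⟩ := (hl y).1 hy
    exact h i hi
  clear hl
  induction l with
  | nil => simp
  | cons x l ih =>
    rw [List.prod_cons, mul_assoc, ih fun y hy => hl' y (List.mem_cons_of_mem _ hy),
      hl' x List.mem_cons_self]

theorem listProd_mul_eq_zero {S : Set ι} (hS : S.Finite) {f : ι → A} {w : A}
    (hc : ∀ i ∈ S, ∀ j ∈ S, Commute (f i) (f j)) {i : ι} (hi : i ∈ S) (h : f i * w = 0) :
    listProd S f * w = 0 := by
  refine listProd_induction (fun p => p * w = 0) fun l hl => ?_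
  have hx : f i ∈ l := (hl _).2 ⟨hS, i, hi, rfl⟩
  have hcomm : ∀ y ∈ l, Commute (f i) y := fun y hy => by
    obtain ⟨-, j, hj, rfl⟩ := (hl y).1 hy
    exact hc i hi j hj
  clear hl
  induction l with
  | nil => simp at hx
  | cons x l ih =>
    rw [List.prod_cons]
    rcases List.mem_cons.1 hx with rfl | hx
    · rw [(Commute.list_prod_right l (f i)
        fun y hy => hcomm y (List.mem_cons_of_mem _ hy)).eq, mul_assoc, h, mul_zero]
    · rw [mul_assoc, ih hx fun y hy => hcomm y (List.mem_cons_of_mem _ hy), mul_zero]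

end ListProd

namespace KGraph.TCKFamily

variable {k : ℕ} {Λ : KGraph k} {A : Type*} [Ring A] [StarRing A] {t : Λ.Path → A}

theorem star_vertex (ht : Λ.TCKFamily t) {v : Λ.Path} (hv : Λ.IsVertex v) : star (t v) = t v :=
  (ht.1 v hv).1

theorem mul_comp (ht : Λ.TCKFamily t) {lam mu : Λ.Path} (h : Λ.s lam = Λ.r mu) :
    t lam * t mu = t (Λ.comp lam mu) :=
  ht.2.2.1 lam mu h

theorem mul_s (ht : Λ.TCKFamily t) (lam : Λ.Path) : t lam * t (Λ.s lam) = t lam := by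
  rw [ht.mul_comp (Λ.r_s lam).symm, Λ.comp_source]

theorem r_mul (ht : Λ.TCKFamily t) (lam : Λ.Path) : t (Λ.r lam) * t lam = t lam := by
  rw [ht.mul_comp (Λ.s_r lam), Λ.range_comp]

theorem s_mul_star (ht : Λ.TCKFamily t) (lam : Λ.Path) :
    t (Λ.s lam) * star (t lam) = star (t lam) := by
  have h := congrArg star (ht.mul_s lam)
  rwa [star_mul, ht.star_vertex (isVertex_s lam)] at h

theorem star_mul_r (ht : Λ.TCKFamily t) (lam : Λ.Path) :
    star (t lam) * t (Λ.r lam) = star (t lam) := by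
  have h := congrArg star (ht.r_mul lam)
  rwa [star_mul, ht.star_vertex (isVertex_r lam)] at h

theorem star_mul_self (ht : Λ.TCKFamily t) (lam : Λ.Path) :
    star (t lam) * t lam = t (Λ.s lam) := by
  have h : Λ.Lmin lam lam = {(Λ.s lam, Λ.s lam)} := by
    ext ⟨a, b⟩
    have hsl : Λ.comp lam (Λ.s lam) = lam := Λ.comp_source lam
    have hlam : lam ∈ Λ.MCE lam lam :=
      mem_MCE.2 ⟨(sup_idem _).symm, Pre.refl _, Pre.refl _⟩
    constructor
    · rintro ⟨h₁, h₂, h₃, h₄⟩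
      have h₅ : Λ.comp lam a = Λ.comp lam (Λ.s lam) := by
        rw [hsl]
        exact ((mem_MCE.1 h₄).2.1.eq_of_d_eq (Pre.refl _) (by rw [(mem_MCE.1 h₄).1, sup_idem])
          |>.symm)
      have h₆ := (comp_inj h₁ (Λ.r_s lam).symm h₅ rfl).2
      have h₇ := (comp_inj h₂ (Λ.r_s lam).symm (h₃.symm.trans h₅) rfl).2
      simp only at h₆ h₇
      rw [h₆, h₇]
      rfl
    · intro h
      obtain ⟨rfl, rfl⟩ := Prod.mk.inj h
      exact ⟨(Λ.r_s _).symm, (Λ.r_s _).symm, rfl, by rwa [hsl]⟩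
  rw [ht.2.2.2, h, finsum_mem_singleton, ht.star_vertex (isVertex_s lam)]
  simpa only [Λ.s_s] using ht.mul_s (Λ.s lam)

theorem star_mul_eq_zero (ht : Λ.TCKFamily t) {lam mu : Λ.Path}
    (h : ∀ kap, ¬ (Pre lam kap ∧ Pre mu kap)) : star (t lam) * t mu = 0 := by
  rw [ht.2.2.2]
  have : Λ.Lmin lam mu = ∅ := Set.eq_empty_of_forall_notMem fun p hp =>
    h _ (mem_MCE.1 hp.2.2.2).2
  rw [this, finsum_mem_empty]

theorem star_mul_eq_zero_of_d_eq (ht : Λ.TCKFamily t) {lam mu : Λ.Path} (hd : Λ.d lam = Λ.d mu)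
    (hne : lam ≠ mu) : star (t lam) * t mu = 0 :=
  ht.star_mul_eq_zero fun _ h => hne (h.1.eq_of_d_eq h.2 hd)

theorem star_mul_comp (ht : Λ.TCKFamily t) {lam alpha : Λ.Path} (h : Λ.s lam = Λ.r alpha) :
    star (t lam) * t (Λ.comp lam alpha) = t alpha := by
  rw [← ht.mul_comp h, ← mul_assoc, ht.star_mul_self, h, ht.r_mul]

theorem star_comp_mul (ht : Λ.TCKFamily t) {lam alpha : Λ.Path} (h : Λ.s lam = Λ.r alpha) :
    star (t (Λ.comp lam alpha)) * t lam = star (t alpha) := by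
  have := congrArg star (ht.star_mul_comp h)
  rwa [star_mul, star_star] at this

theorem star_mul_eq_sum (ht : Λ.TCKFamily t) (hΛ : Λ.FinitelyAligned) (lam mu : Λ.Path) :
    star (t lam) * t mu = ∑ p ∈ (finite_Lmin hΛ lam mu).toFinset, t p.1 * star (t p.2) := by
  rw [ht.2.2.2, finsum_mem_eq_finite_toFinset_sum _ (finite_Lmin hΛ lam mu)]

theorem mul_star_mul_eq_zero (ht : Λ.TCKFamily t) (hΛ : Λ.FinitelyAligned) {lam mu : Λ.Path}
    {w : A} (h : ∀ p ∈ Λ.Lmin lam mu, w * t p.1 = 0) : w * (star (t lam) * t mu) = 0 := by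
  rw [ht.star_mul_eq_sum hΛ, Finset.mul_sum]
  refine Finset.sum_eq_zero fun p hp => ?_
  rw [← mul_assoc, h p (by simpa using hp), zero_mul]

theorem star_mul_mul_eq_zero (ht : Λ.TCKFamily t) (hΛ : Λ.FinitelyAligned) {lam mu : Λ.Path}
    {w : A} (h : ∀ p ∈ Λ.Lmin lam mu, star (t p.2) * w = 0) : star (t lam) * (t mu * w) = 0 := by
  rw [← mul_assoc, ht.star_mul_eq_sum hΛ, Finset.sum_mul]
  refine Finset.sum_eq_zero fun p hp => ?_
  rw [mul_assoc, h p (by simpa using hp), mul_zero]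

theorem isStarProjection (ht : Λ.TCKFamily t) (lam : Λ.Path) :
    IsStarProjection (t lam * star (t lam)) := by
  refine ⟨?_, ?_⟩
  · rw [IsIdempotentElem, mul_assoc, ← mul_assoc (star _), ht.star_mul_self, ht.s_mul_star]
  · rw [isSelfAdjoint_iff, star_mul, star_star]

theorem commute (ht : Λ.TCKFamily t) (hΛ : Λ.FinitelyAligned) (lam mu : Λ.Path) :
    Commute (t lam * star (t lam)) (t mu * star (t mu)) := by
  refine ((ht.isStarProjection lam).isSelfAdjoint.commute_iff
    (ht.isStarProjection mu).isSelfAdjoint).2 ?_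
  have : t lam * star (t lam) * (t mu * star (t mu)) =
      ∑ p ∈ (finite_Lmin hΛ lam mu).toFinset,
        t (Λ.comp lam p.1) * star (t (Λ.comp lam p.1)) := by
    rw [mul_assoc, ← mul_assoc (star _), ht.star_mul_eq_sum hΛ, Finset.sum_mul, Finset.mul_sum]
    refine Finset.sum_congr rfl fun p hp => ?_
    obtain ⟨h₁, h₂, h₃, -⟩ : p ∈ Λ.Lmin lam mu := by simpa using hp
    conv_rhs => enter [2]; rw [h₃]
    rw [← ht.mul_comp h₁, ← ht.mul_comp h₂, star_mul]
    simp only [mul_assoc]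
  rw [this]
  exact isSelfAdjoint_sum _ fun p _ => (ht.isStarProjection _).isSelfAdjoint

theorem vertex_eq (ht : Λ.TCKFamily t) {v : Λ.Path} (hv : Λ.IsVertex v) :
    t v * star (t v) = t v := by
  rw [(ht.1 v hv).1, (ht.1 v hv).2]

theorem isStarProjection_sub (ht : Λ.TCKFamily t) {v lam : Λ.Path} (hv : Λ.IsVertex v)
    (hr : Λ.r lam = v) : IsStarProjection (t v - t lam * star (t lam)) := by
  have h := ht.isStarProjection lam
  have h₁ : t v * (t lam * star (t lam)) = t lam * star (t lam) := by
    rw [← mul_assoc, ← hr, ht.r_mul]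
  have h₂ : t lam * star (t lam) * t v = t lam * star (t lam) := by
    rw [mul_assoc, ← hr, ht.star_mul_r]
  refine ⟨?_, ?_⟩
  · rw [IsIdempotentElem, mul_sub, sub_mul, sub_mul, h₁, h₂, h.isIdempotentElem.eq, (ht.1 v hv).2,
      sub_self, sub_zero]
  · rw [isSelfAdjoint_iff, star_sub, ht.star_vertex hv, h.isSelfAdjoint.star_eq]

section GapProd

variable {v : Λ.Path} {E : Set Λ.Path}

theorem commute_sub (ht : Λ.TCKFamily t) (hΛ : Λ.FinitelyAligned) (hv : Λ.IsVertex v)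
    (mu lam : Λ.Path) : Commute (t mu * star (t mu)) (t v - t lam * star (t lam)) := by
  rw [← ht.vertex_eq hv]
  exact (ht.commute hΛ _ _).sub_right (ht.commute hΛ _ _)

theorem commute_sub_sub (ht : Λ.TCKFamily t) (hΛ : Λ.FinitelyAligned) (hv : Λ.IsVertex v)
    (mu lam : Λ.Path) :
    Commute (t v - t mu * star (t mu)) (t v - t lam * star (t lam)) := by
  refine Commute.sub_left ?_ (ht.commute_sub hΛ hv _ _)
  nth_rewrite 1 [← ht.vertex_eq hv]
  exact ht.commute_sub hΛ hv _ _

theorem isStarProjection_gapProd (ht : Λ.TCKFamily t) (hΛ : Λ.FinitelyAligned)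
    (hv : Λ.IsVertex v) (hE : ∀ lam ∈ E, Λ.r lam = v) : IsStarProjection (Λ.gapProd t v E) :=
  isStarProjection_listProd (fun lam h => ht.isStarProjection_sub hv (hE lam h))
    fun _ _ _ _ => ht.commute_sub_sub hΛ hv _ _

theorem commute_gapProd (ht : Λ.TCKFamily t) (hΛ : Λ.FinitelyAligned) (hv : Λ.IsVertex v)
    (mu : Λ.Path) : Commute (t mu * star (t mu)) (Λ.gapProd t v E) :=
  commute_listProd fun _ _ => ht.commute_sub hΛ hv _ _

theorem gapProd_mul_eq_zero (ht : Λ.TCKFamily t) (hΛ : Λ.FinitelyAligned) (hv : Λ.IsVertex v)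
    (hfin : E.Finite) (hE : ∀ lam ∈ E, Λ.r lam = v) {nu : Λ.Path} (hnu : nu ∈ E) :
    Λ.gapProd t v E * t nu = 0 := by
  refine listProd_mul_eq_zero hfin (fun _ _ _ _ => ht.commute_sub_sub hΛ hv _ _) hnu ?_
  rw [sub_mul, mul_assoc, ht.star_mul_self, ht.mul_s, ← hE nu hnu, ht.r_mul, sub_self]

theorem gapProd_mul_eq_self {w : A} (hw : t v * w = w) (h : ∀ nu ∈ E, star (t nu) * w = 0) :
    Λ.gapProd t v E * w = w :=
  listProd_mul_eq_self fun nu hnu => by rw [sub_mul, mul_assoc, h nu hnu, mul_zero, hw, sub_zero]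

theorem star_mul_gapProd (ht : Λ.TCKFamily t) (hΛ : Λ.FinitelyAligned) (hv : Λ.IsVertex v)
    (hfin : E.Finite) (hE : ∀ lam ∈ E, Λ.r lam = v) {nu : Λ.Path} (hnu : nu ∈ E) :
    star (t nu) * Λ.gapProd t v E = 0 := by
  have h := congrArg star (ht.gapProd_mul_eq_zero hΛ hv hfin hE hnu)
  rwa [star_mul, (ht.isStarProjection_gapProd hΛ hv hE).isSelfAdjoint.star_eq, star_zero] at h

end GapProd

end KGraph.TCKFamily
namespace KGraph

variable {k : ℕ} {Λ : KGraph k}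

/-- The paths of nonzero degree which extend `rho` to an element of `G`. -/
def tails (G : Set Λ.Path) (rho : Λ.Path) : Set Λ.Path :=
  {nu | Λ.s rho = Λ.r nu ∧ ¬ Λ.IsVertex nu ∧ Λ.comp rho nu ∈ G}

theorem finite_tails {G : Set Λ.Path} (hG : G.Finite) (rho : Λ.Path) : (tails G rho).Finite := by
  refine Set.Finite.of_finite_image (f := Λ.comp rho) (hG.subset ?_) ?_
  · rintro _ ⟨nu, h, rfl⟩
    exact h.2.2
  · intro nu h mu h' e
    exact (comp_inj h.1 h'.1 e rfl).2

theorem tails_congr {G : Set Λ.Path} (hG : IsClosedSet G) {rho sig : Λ.Path} (hr : rho ∈ G)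
    (hs : sig ∈ G) (hd : Λ.d rho = Λ.d sig) (h : Λ.s rho = Λ.s sig) :
    tails G rho = tails G sig := by
  ext nu
  constructor
  · rintro ⟨h₁, h₂, h₃⟩
    exact ⟨h ▸ h₁, h₂, hG.swap _ hs _ hr _ hd.symm h.symm h₁ h₃⟩
  · rintro ⟨h₁, h₂, h₃⟩
    exact ⟨h ▸ h₁, h₂, hG.swap _ hr _ hs _ hd h h₁ h₃⟩

theorem not_isVertex_of_comp_ne {mu alpha : Λ.Path} (h : Λ.s mu = Λ.r alpha)
    (hne : Λ.comp mu alpha ≠ mu) : ¬ Λ.IsVertex alpha := fun hv =>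
  hne (by rw [← hv.r_eq, ← h, Λ.comp_source])

/-- `rho` and `sig` are extensions of `lam` and `mu` by the same path. -/
def SameTail (lam mu rho sig : Λ.Path) : Prop :=
  ∃ alpha, Λ.s lam = Λ.r alpha ∧ Λ.s mu = Λ.r alpha ∧ Λ.comp lam alpha = rho ∧
    Λ.comp mu alpha = sig

theorem SameTail.s_eq {lam mu rho sig : Λ.Path} (h : SameTail lam mu rho sig) :
    Λ.s rho = Λ.s sig := by
  obtain ⟨alpha, h₁, h₂, rfl, rfl⟩ := h
  rw [Λ.s_comp _ _ h₁, Λ.s_comp _ _ h₂]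

theorem SameTail.d_eq_iff {lam mu rho sig : Λ.Path} (h : SameTail lam mu rho sig) :
    Λ.d rho = Λ.d sig ↔ Λ.d lam = Λ.d mu := by
  obtain ⟨alpha, h₁, h₂, rfl, rfl⟩ := h
  rw [Λ.d_comp _ _ h₁, Λ.d_comp _ _ h₂, add_left_inj]

namespace TCKFamily

variable {A : Type*} [Ring A] [StarRing A] {t : Λ.Path → A} {G : Finset Λ.Path}

theorem mul_star_mul_eq_zero_of_not_pre (ht : Λ.TCKFamily t) (hΛ : Λ.FinitelyAligned)
    (hG : IsClosedSet (G : Set Λ.Path)) {rho lam : Λ.Path} (hr : rho ∈ G) (hl : lam ∈ G) {w : A}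
    (hw : ∀ nu ∈ tails (G : Set Λ.Path) rho, w * t nu = 0) (h : ¬ Pre lam rho) :
    w * (star (t rho) * t lam) = 0 := by
  refine ht.mul_star_mul_eq_zero hΛ fun p hp => hw _ ?_
  obtain ⟨h₁, h₂, h₃, h₄⟩ := hp
  refine ⟨h₁, not_isVertex_of_comp_ne h₁ fun e => h ?_, hG.mce _ hr _ hl h₄⟩
  rw [← e, h₃]
  exact pre_comp h₂

theorem mul_star_mul_mul_eq_zero (ht : Λ.TCKFamily t) (hΛ : Λ.FinitelyAligned)
    (hG : IsClosedSet (G : Set Λ.Path)) {rho sig : Λ.Path} (hr : rho ∈ G) (hs : sig ∈ G)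
    (hne : rho ≠ sig) {w w' : A} (hw : ∀ nu ∈ tails (G : Set Λ.Path) rho, w * t nu = 0)
    (hw' : ∀ nu ∈ tails (G : Set Λ.Path) sig, star (t nu) * w' = 0) :
    w * (star (t rho) * t sig) * w' = 0 := by
  by_cases h : Pre sig rho
  · obtain ⟨alpha, h₁, rfl⟩ := h
    rw [ht.star_comp_mul h₁, mul_assoc,
      hw' alpha ⟨h₁, not_isVertex_of_comp_ne h₁ hne, hr⟩, mul_zero]
  · rw [ht.mul_star_mul_eq_zero_of_not_pre hΛ hG hr hs hw h, zero_mul]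

theorem r_of_mem_tails {S : Set Λ.Path} {rho nu : Λ.Path} (h : nu ∈ tails S rho) :
    Λ.r nu = Λ.s rho := h.1.symm

/-- The gap projection of `rho` with respect to `G`. -/
noncomputable def gap (t : Λ.Path → A) (G : Finset Λ.Path) (rho : Λ.Path) : A :=
  Λ.gapProd t (Λ.s rho) (tails (G : Set Λ.Path) rho)

theorem gap_mul (ht : Λ.TCKFamily t) (hΛ : Λ.FinitelyAligned) {rho nu : Λ.Path}
    (h : nu ∈ tails (G : Set Λ.Path) rho) : gap t G rho * t nu = 0 :=
  ht.gapProd_mul_eq_zero hΛ (isVertex_s rho) (finite_tails G.finite_toSet rho)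
    (fun _ => r_of_mem_tails) h

theorem star_mul_gap (ht : Λ.TCKFamily t) (hΛ : Λ.FinitelyAligned) {rho nu : Λ.Path}
    (h : nu ∈ tails (G : Set Λ.Path) rho) : star (t nu) * gap t G rho = 0 :=
  ht.star_mul_gapProd hΛ (isVertex_s rho) (finite_tails G.finite_toSet rho)
    (fun _ => r_of_mem_tails) h

theorem isStarProjection_gap (ht : Λ.TCKFamily t) (hΛ : Λ.FinitelyAligned) (rho : Λ.Path) :
    IsStarProjection (gap t G rho) :=
  ht.isStarProjection_gapProd hΛ (isVertex_s rho) fun _ => r_of_mem_tails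

theorem gap_commute (ht : Λ.TCKFamily t) (hΛ : Λ.FinitelyAligned) (rho : Λ.Path) :
    Commute (t (Λ.s rho)) (gap t G rho) := by
  rw [← ht.vertex_eq (isVertex_s rho)]
  exact ht.commute_gapProd hΛ (isVertex_s rho) _

theorem star_mul_sum_gap (ht : Λ.TCKFamily t) (hΛ : Λ.FinitelyAligned)
    (hG : IsClosedSet (G : Set Λ.Path)) {rho : Λ.Path} (hr : rho ∈ G) :
    star (t rho) * ∑ sig ∈ G, t sig * gap t G sig * star (t sig) = star (t rho) := by
  set e := ∑ sig ∈ G, t sig * gap t G sig * star (t sig) with he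
  let N := ∑ sig ∈ G, ∑ i, Λ.d sig i
  have hN : ∀ sig ∈ G, ∑ i, Λ.d sig i ≤ N := fun sig h =>
    Finset.single_le_sum (f := fun sig => ∑ i, Λ.d sig i) (fun _ _ => Nat.zero_le _) h
  suffices H : ∀ n, ∀ rho ∈ G, N - ∑ i, Λ.d rho i = n → star (t rho) * (1 - e) = 0 by
    have := H _ rho hr rfl
    rw [mul_sub, mul_one, sub_eq_zero] at this
    exact this.symm
  intro n
  induction n using Nat.strong_induction_on with
  | _ n ih =>
    intro rho hr hn
    have hgap : gap t G rho * (star (t rho) * (1 - e)) = star (t rho) * (1 - e) := by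
      refine gapProd_mul_eq_self ?_ fun nu hnu => ?_
      · rw [← mul_assoc, ht.s_mul_star]
      · rw [← mul_assoc, ← star_mul, ht.mul_comp hnu.1]
        refine ih _ ?_ _ hnu.2.2 rfl
        have h₁ := hN _ hnu.2.2
        rw [Λ.d_comp _ _ hnu.1] at h₁ ⊢
        simp only [Pi.add_apply, Finset.sum_add_distrib] at h₁ ⊢
        have h₂ : ∑ i, Λ.d nu i ≠ 0 := fun h₃ => hnu.2.1 <| funext fun i =>
          (Finset.sum_eq_zero_iff.1 h₃) i (Finset.mem_univ i)
        omega
    have hsum : gap t G rho * (star (t rho) * e) = gap t G rho * star (t rho) := by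
      rw [he, Finset.mul_sum, Finset.mul_sum, Finset.sum_eq_single_of_mem rho hr]
      · rw [← mul_assoc (star (t rho)), ← mul_assoc (star (t rho)), ht.star_mul_self,
          (ht.gap_commute hΛ rho).eq, mul_assoc, ht.s_mul_star, ← mul_assoc,
          (ht.isStarProjection_gap hΛ rho).isIdempotentElem.eq]
      · intro sig hs hne
        have := ht.mul_star_mul_mul_eq_zero hΛ hG hr hs hne.symm (fun _ h => ht.gap_mul hΛ h)
          (fun _ h => ht.star_mul_gap hΛ h)
        simp only [← mul_assoc] at this ⊢
        rw [this, zero_mul]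
    rw [← hgap, mul_sub, mul_sub, mul_one, hsum, sub_self]

theorem mul_star_eq_sum (ht : Λ.TCKFamily t) (hΛ : Λ.FinitelyAligned)
    (hG : IsClosedSet (G : Set Λ.Path)) {lam mu : Λ.Path} (hl : lam ∈ G) (hm : mu ∈ G)
    (hd : Λ.d lam = Λ.d mu) (h : Λ.s lam = Λ.s mu) :
    t lam * star (t mu) = ∑ rho ∈ G, ∑ sig ∈ G,
      if SameTail lam mu rho sig then t rho * gap t G sig * star (t sig) else 0 := by
  rw [← ht.star_mul_sum_gap hΛ hG hm, Finset.mul_sum, Finset.mul_sum, Finset.sum_comm]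
  refine Finset.sum_congr rfl fun sig hs => ?_
  by_cases hp : Pre mu sig
  · obtain ⟨alpha, ha, rfl⟩ := hp
    have hla : Λ.s lam = Λ.r alpha := h.trans ha
    rw [Finset.sum_eq_single_of_mem (Λ.comp lam alpha) (hG.swap _ hl _ hm _ hd h ha hs),
      if_pos ⟨alpha, hla, ha, rfl, rfl⟩]
    · rw [← mul_assoc (star (t mu)), ← mul_assoc (star (t mu)), ht.star_mul_comp ha,
        ← ht.mul_comp hla]
      simp only [mul_assoc]
    · rintro rho - hne
      refine if_neg ?_
      rintro ⟨beta, h₁, h₂, rfl, h₄⟩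
      rw [(comp_inj h₂ ha h₄ rfl).2] at hne
      exact hne rfl
  · rw [Finset.sum_eq_zero]
    · have h₁ := ht.mul_star_mul_eq_zero_of_not_pre hΛ hG hs hm (fun _ h => ht.gap_mul hΛ h) hp
      have h₂ := congrArg star h₁
      rw [star_mul, star_mul, star_star, (ht.isStarProjection_gap hΛ sig).isSelfAdjoint.star_eq,
        star_zero] at h₂
      rw [← mul_assoc (star (t mu)), ← mul_assoc (star (t mu)), h₂, zero_mul, mul_zero]
    · intro rho _
      refine if_neg ?_
      rintro ⟨beta, h₁, h₂, h₃, h₄⟩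
      exact hp (h₄ ▸ pre_comp h₂)

/-- Compressing `t lam * star (t mu)` by corner projections `t rho * q * star (t rho)`. -/
theorem compress (ht : Λ.TCKFamily t) (hΛ : Λ.FinitelyAligned)
    (hG : IsClosedSet (G : Set Λ.Path)) {v lam mu rho sig : Λ.Path} (hl : lam ∈ G) (hm : mu ∈ G)
    (hr : rho ∈ G) (hs : sig ∈ G) (hrv : Λ.s rho = v) {q : A}
    (hq : IsStarProjection q) (hqr : ∀ nu ∈ tails (G : Set Λ.Path) rho, q * t nu = 0)
    (hqs : ∀ nu ∈ tails (G : Set Λ.Path) sig, q * t nu = 0) (hqv : q * t v = q)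
    (hqt : ∀ beta gamma, Λ.s lam = Λ.r beta → Λ.s mu = Λ.r gamma → Λ.comp lam beta = rho →
      Λ.comp mu gamma = sig → beta ≠ gamma → q * (star (t beta) * t gamma) * q = 0) :
    t rho * q * star (t rho) * (t lam * star (t mu)) * (t sig * q * star (t sig)) =
      if SameTail lam mu rho sig then t rho * q * star (t sig) else 0 := by
  have hstar : ∀ nu, star (q * (star (t sig) * t nu)) = star (t nu) * t sig * q := by
    intro nu
    rw [star_mul, star_mul, star_star, hq.isSelfAdjoint.star_eq]
  have hassoc : t rho * q * star (t rho) * (t lam * star (t mu)) * (t sig * q * star (t sig)) =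
      t rho * (q * (star (t rho) * t lam) * (star (t mu) * t sig * q)) * star (t sig) := by
    simp only [mul_assoc]
  rw [hassoc]
  by_cases h₁ : Pre lam rho
  · by_cases h₂ : Pre mu sig
    · obtain ⟨beta, hb, rfl⟩ := h₁
      obtain ⟨gamma, hg, rfl⟩ := h₂
      rw [ht.star_comp_mul hb, ht.star_mul_comp hg]
      by_cases hbg : beta = gamma
      · subst hbg
        rw [if_pos ⟨beta, hb, hg, rfl, rfl⟩, mul_assoc q, ← mul_assoc (star _), ht.star_mul_self,
          ← Λ.s_comp _ _ hb, hrv, ← mul_assoc q, hqv, hq.isIdempotentElem.eq]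
      · have h : q * star (t beta) * (t gamma * q) = 0 := by
          simpa only [← mul_assoc] using hqt beta gamma hb hg rfl rfl hbg
        rw [if_neg, h]
        · simp
        · rintro ⟨alpha, h₁, h₂, h₃, h₄⟩
          exact hbg ((comp_inj h₁ hb h₃ rfl).2.symm.trans (comp_inj h₂ hg h₄ rfl).2)
    · have h := hstar mu
      rw [ht.mul_star_mul_eq_zero_of_not_pre hΛ hG hs hm hqs h₂, star_zero] at h
      rw [if_neg, ← h]
      · simp
      · rintro ⟨alpha, h₃, h₄, h₅, h₆⟩
        exact h₂ (h₆ ▸ pre_comp h₄)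
  · rw [if_neg, ht.mul_star_mul_eq_zero_of_not_pre hΛ hG hr hl hqr h₁]
    · simp
    · rintro ⟨alpha, h₃, h₄, h₅, h₆⟩
      exact h₁ (h₅ ▸ pre_comp h₃)

end TCKFamily

end KGraph
namespace KGraph

variable {k : ℕ} {Λ : KGraph k}

theorem ext_nonempty {lam nu kap : Λ.Path} {E : Set Λ.Path} (hnu : nu ∈ E) (h₁ : Pre lam kap)
    (h₂ : Pre nu kap) : ∃ alpha ∈ Λ.Ext lam E, Pre (Λ.comp lam alpha) kap := by
  obtain ⟨m, hm, hmk⟩ := exists_MCE_of_pre h₁ h₂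
  obtain ⟨-, ⟨alpha, ha, rfl⟩, ⟨beta, hb, hab⟩⟩ := mem_MCE.1 hm
  exact ⟨alpha, ⟨ha.symm, nu, hnu, beta, ha, hb, hab.symm, hm⟩, hmk⟩

theorem exists_of_mem_ext {lam alpha : Λ.Path} {E : Set Λ.Path} (h : alpha ∈ Λ.Ext lam E) :
    Λ.s lam = Λ.r alpha ∧ ∃ nu ∈ E, Pre nu (Λ.comp lam alpha) := by
  obtain ⟨-, nu, hnu, beta, h₁, h₂, h₃, -⟩ := h
  exact ⟨h₁, nu, hnu, h₃ ▸ pre_comp h₂⟩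

theorem finite_ext (hΛ : Λ.FinitelyAligned) (lam : Λ.Path) {E : Set Λ.Path} (hE : E.Finite) :
    (Λ.Ext lam E).Finite := by
  refine (hE.biUnion fun nu _ => (finite_Lmin hΛ lam nu).image Prod.fst).subset ?_
  rintro alpha ⟨-, nu, hnu, beta, h⟩
  exact Set.mem_biUnion hnu ⟨_, h, rfl⟩

theorem Exhaustive.ext {v xi : Λ.Path} {E : Set Λ.Path} (hE : Λ.Exhaustive v E)
    (hxi : Λ.r xi = v) : Λ.Exhaustive (Λ.s xi) (Λ.Ext xi E) := by
  intro lam hlam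
  obtain ⟨alpha, ha⟩ := hE (Λ.comp xi lam) (by rw [Λ.r_comp _ _ hlam.symm, hxi])
  obtain ⟨hra, nu, hnu, hpre⟩ := exists_of_mem_ext ha
  have h₁ : Pre (Λ.comp xi lam) (Λ.comp (Λ.comp xi lam) alpha) := pre_comp hra
  obtain ⟨beta, hb, gamma, hg, hk⟩ := ext_nonempty hnu ((pre_comp hlam.symm).trans h₁) hpre
  have hrb := (exists_of_mem_ext hb).1
  rw [Λ.s_comp _ _ hlam.symm] at hra
  rw [Λ.s_comp _ _ hrb] at hg
  rw [Λ.comp_assoc _ _ _ hrb hg, Λ.comp_assoc _ _ _ hlam.symm hra] at hk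
  have h₂ := (comp_inj (by rw [Λ.r_comp _ _ hg, hrb]) (by rw [Λ.r_comp _ _ hra, hlam]) hk rfl).2
  obtain ⟨delta, hd, -⟩ := ext_nonempty hb (pre_comp hra) (h₂ ▸ pre_comp hg)
  exact ⟨delta, hd⟩

theorem _root_.GMor.hasInit_of_pre {x : GMor Λ} {T : Set Λ.Path} {nu : Λ.Path} (hnu : nu ∈ T)
    {n : Fin k → ℕ} (hn : ∀ i, (n i : ℕ∞) ≤ x.len i) (h : Pre nu (x.seg 0 n)) : x.HasInit T := by
  have hle : Λ.d nu ≤ n := by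
    have := h.d_le
    rwa [x.d_seg_zero hn] at this
  have hnl := GMor.le_len_of_le hle hn
  exact ⟨nu, hnu, hnl, (x.pre_seg hle hn).eq_of_d_eq h (x.d_seg_zero hnl)⟩

section

variable {A : Type*} [Ring A] [StarRing A] {t : Λ.Path → A} {𝓔 : Set (Set Λ.Path)}
  {v : Λ.Path} {T : Set Λ.Path}

theorem TCKFamily.ne_zero (ht : Λ.TCKFamily t) (hnz : ∀ v, Λ.IsVertex v → t v ≠ 0)
    (lam : Λ.Path) : t lam ≠ 0 := by
  intro h
  have := ht.star_mul_self lam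
  rw [h, mul_zero] at this
  exact hnz _ (isVertex_s lam) this.symm

theorem TCKFamily.mul_gapProd_of_mem (ht : Λ.TCKFamily t) (hΛ : Λ.FinitelyAligned)
    (hv : Λ.IsVertex v) (hT : T.Finite) (hTv : ∀ nu ∈ T, Λ.r nu = v) (hne : T.Nonempty) :
    t v * Λ.gapProd t v T = Λ.gapProd t v T := by
  obtain ⟨nu, hnu⟩ := hne
  have h : Λ.gapProd t v T * (1 - t v) = 0 := by
    refine listProd_mul_eq_zero hT (fun _ _ _ _ => ht.commute_sub_sub hΛ hv _ _) hnu ?_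
    rw [mul_sub, mul_one, sub_mul, (ht.1 v hv).2, mul_assoc, ← hTv nu hnu, ht.star_mul_r, sub_self]
  rw [mul_sub, mul_one, sub_eq_zero] at h
  have hc := ht.commute_gapProd (E := T) hΛ hv v
  rw [ht.vertex_eq hv] at hc
  rw [hc.eq]
  exact h.symm

theorem RCKFamily.exists_separating (ht : Λ.RCKFamily 𝓔 t) (hΛ : Λ.FinitelyAligned)
    (hC : Λ.CondC 𝓔) (hnz : ∀ v, Λ.IsVertex v → t v ≠ 0)
    (hfe : ∀ F v, Λ.FEat v F → F ∉ 𝓔 → Λ.gapProd t v F ≠ 0) (hv : Λ.IsVertex v)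
    (hT : T.Finite) (hTv : ∀ nu ∈ T, Λ.r nu = v ∧ ¬ Λ.IsVertex nu) (hgap : Λ.gapProd t v T ≠ 0)
    {P : Set (Λ.Path × Λ.Path)} (hP : P.Finite)
    (hPv : ∀ p ∈ P, p.1 ≠ p.2 ∧ Λ.s p.1 = v ∧ Λ.s p.2 = v) :
    ∃ xi, Λ.r xi = v ∧ Λ.gapProd t v T * t xi ≠ 0 ∧ ∀ p ∈ P, ∀ kap,
      ¬ (Pre (Λ.comp p.1 xi) kap ∧ Pre (Λ.comp p.2 xi) kap) := by
  by_cases hex : Λ.Exhaustive v T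
  · have hFE : Λ.FEat v T :=
      ⟨hv, fun nu hnu => ⟨(hTv nu hnu).1, fun e => (hTv nu hnu).2 (e ▸ hv)⟩, hT, hex⟩
    obtain ⟨x, hxb, rfl, hinit, hxa⟩ := hC.2 v T hFE fun h => hgap (ht.2 T h v hFE)
    obtain ⟨m, hm, hsep⟩ := hxa.exists_seg_of_finite hΛ hP hPv
    set xi := x.seg 0 m with hxi
    have hr : Λ.r xi = x.range := x.r_seg_zero hm
    have hs : Λ.s xi = x.seg m m := x.s_seg 0 m zero_le hm
    have hne : (Λ.Ext xi T).Nonempty := hex xi hr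
    have hX : Λ.FEat (Λ.s xi) (Λ.Ext xi T) := by
      refine ⟨isVertex_s xi, fun alpha ha => ?_, finite_ext hΛ xi hT, hex.ext hr⟩
      obtain ⟨h₁, nu, hnu, hpre⟩ := exists_of_mem_ext ha
      refine ⟨h₁.symm, fun e => hinit (GMor.hasInit_of_pre hnu hm ?_)⟩
      rwa [e, Λ.comp_source] at hpre
    have hX𝓔 : Λ.Ext xi T ∉ 𝓔 := by
      intro h
      obtain ⟨alpha, ha, hlen, hseg⟩ := hxb m hm _ h (hs ▸ hX)
      obtain ⟨-, nu, hnu, hpre⟩ := exists_of_mem_ext ha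
      refine hinit (GMor.hasInit_of_pre hnu hlen ?_)
      rwa [← (x.seg_zero_spec (p := m) le_self_add hlen).2, hseg]
    have hw := hfe _ _ hX hX𝓔
    have hsw := ht.1.mul_gapProd_of_mem hΛ (isVertex_s xi) hX.2.2.1 (fun nu h => (hX.2.1 nu h).1)
      hne
    refine ⟨xi, hr, fun h0 => hw ?_, hsep⟩
    have hfix : Λ.gapProd t x.range T * (t xi * Λ.gapProd t (Λ.s xi) (Λ.Ext xi T)) =
        t xi * Λ.gapProd t (Λ.s xi) (Λ.Ext xi T) := by
      refine TCKFamily.gapProd_mul_eq_self ?_ fun nu hnu => ?_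
      · rw [← mul_assoc, ← hr, ht.1.r_mul]
      · refine ht.1.star_mul_mul_eq_zero hΛ fun p hp => ?_
        refine ht.1.star_mul_gapProd hΛ (isVertex_s xi) hX.2.2.1 (fun nu h => (hX.2.1 nu h).1) ?_
        obtain ⟨h₁, h₂, h₃, h₄⟩ := hp
        refine ⟨h₂.symm, nu, hnu, p.1, h₂, h₁, h₃.symm, ?_⟩
        rw [← h₃]
        have h₅ := mem_MCE.1 h₄
        exact mem_MCE.2 ⟨h₅.1.trans (sup_comm _ _), h₅.2.2, h₅.2.1⟩
    rw [← mul_assoc, h0, zero_mul] at hfix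
    rw [← hsw, ← ht.1.star_mul_self, mul_assoc, ← hfix, mul_zero]
  · obtain ⟨lam, hlam, hemp⟩ : ∃ lam, Λ.r lam = v ∧ ¬ (Λ.Ext lam T).Nonempty := by
      simpa [Exhaustive] using hex
    obtain ⟨x, -, hxr, hxa⟩ := hC.1 (Λ.s lam) (isVertex_s lam)
    have hPl : ∀ p ∈ P, Λ.s p.1 = Λ.r lam ∧ Λ.s p.2 = Λ.r lam := fun p hp => by
      rw [hlam]
      exact (hPv p hp).2
    obtain ⟨m, hm, hsep⟩ := hxa.exists_seg_of_finite hΛ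
      (hP.image fun p => (Λ.comp p.1 lam, Λ.comp p.2 lam)) (by
        rintro _ ⟨p, hp, rfl⟩
        obtain ⟨h₁, h₂⟩ := hPl p hp
        refine ⟨fun e => (hPv p hp).1 (comp_inj h₁ h₂ e ?_).1, ?_, ?_⟩
        · have := congrArg Λ.d e
          simp only at this
          rwa [Λ.d_comp _ _ h₁, Λ.d_comp _ _ h₂, add_left_inj] at this
        · rw [Λ.s_comp _ _ h₁, hxr]
        · rw [Λ.s_comp _ _ h₂, hxr])
    have hsr : Λ.s lam = Λ.r (x.seg 0 m) := by rw [x.r_seg_zero hm, hxr]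
    have hrv : Λ.r (Λ.comp lam (x.seg 0 m)) = v := by rw [Λ.r_comp _ _ hsr, hlam]
    refine ⟨Λ.comp lam (x.seg 0 m), hrv, ?_, fun p hp kap => ?_⟩
    · rw [TCKFamily.gapProd_mul_eq_self]
      · exact ht.1.ne_zero hnz _
      · nth_rewrite 1 [← hrv]
        rw [ht.1.r_mul]
      · intro nu hnu
        refine ht.1.star_mul_eq_zero fun kap h => hemp ?_
        obtain ⟨alpha, ha, -⟩ := ext_nonempty hnu ((pre_comp hsr).trans h.2) h.1
        exact ⟨alpha, ha⟩
    · obtain ⟨h₁, h₂⟩ := hPl p hp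
      have := hsep _ ⟨p, hp, rfl⟩ kap
      rwa [Λ.comp_assoc _ _ _ h₁ hsr, Λ.comp_assoc _ _ _ h₂ hsr] at this

theorem RCKFamily.exists_projection (ht : Λ.RCKFamily 𝓔 t) (hΛ : Λ.FinitelyAligned)
    (hC : Λ.CondC 𝓔) (hnz : ∀ v, Λ.IsVertex v → t v ≠ 0)
    (hfe : ∀ F v, Λ.FEat v F → F ∉ 𝓔 → Λ.gapProd t v F ≠ 0) (hv : Λ.IsVertex v)
    (hT : T.Finite) (hTv : ∀ nu ∈ T, Λ.r nu = v ∧ ¬ Λ.IsVertex nu) (hgap : Λ.gapProd t v T ≠ 0)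
    {P : Set (Λ.Path × Λ.Path)} (hP : P.Finite)
    (hPv : ∀ p ∈ P, p.1 ≠ p.2 ∧ Λ.s p.1 = v ∧ Λ.s p.2 = v) :
    ∃ q : A, IsStarProjection q ∧ q ≠ 0 ∧ (∀ nu ∈ T, q * t nu = 0) ∧ q * t v = q ∧
      ∀ p ∈ P, q * (star (t p.1) * t p.2) * q = 0 := by
  obtain ⟨xi, hr, hne, hsep⟩ := ht.exists_separating hΛ hC hnz hfe hv hT hTv hgap hP hPv
  have hcomm := ht.1.commute_gapProd (E := T) hΛ hv xi
  have hproj := ht.1.isStarProjection_gapProd (E := T) hΛ hv fun nu h => (hTv nu h).1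
  refine ⟨Λ.gapProd t v T * (t xi * star (t xi)),
    hproj.mul (ht.1.isStarProjection xi) hcomm.symm, fun h => hne ?_, fun nu hnu => ?_, ?_,
    fun p hp => ?_⟩
  · have h₁ := congrArg (· * t xi) h
    simp only [mul_assoc, ht.1.star_mul_self, ht.1.mul_s, zero_mul] at h₁
    exact h₁
  · rw [← hcomm.eq, mul_assoc,
      ht.1.gapProd_mul_eq_zero hΛ hv hT (fun nu h => (hTv nu h).1) hnu, mul_zero]
  · rw [← hr, mul_assoc, mul_assoc, ht.1.star_mul_r]
  · have h₁ : star (t (Λ.comp p.1 xi)) * t (Λ.comp p.2 xi) = 0 :=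
      ht.1.star_mul_eq_zero (hsep p hp)
    rw [← ht.1.mul_comp ((hPv p hp).2.1.trans hr.symm),
      ← ht.1.mul_comp ((hPv p hp).2.2.trans hr.symm), star_mul] at h₁
    nth_rewrite 2 [← hcomm.eq]
    have h₂ : Λ.gapProd t v T * (t xi * star (t xi)) * (star (t p.1) * t p.2) *
        (t xi * star (t xi) * Λ.gapProd t v T) = Λ.gapProd t v T * (t xi *
          (star (t xi) * star (t p.1) * (t p.2 * t xi)) * star (t xi) * Λ.gapProd t v T) := by
      simp only [mul_assoc]
    rw [h₂, h₁]
    simp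

end

end KGraph
section OrthogonalSum

variable {A : Type*} [NormedRing A] [StarRing A] [CStarRing A]

theorem norm_sum_pow_le_of_orthogonal {K : Type*} (S : Finset K) (n : ℕ) : ∀ (x : K → A) (B : ℝ),
    (∀ c ∈ S, ∀ c' ∈ S, c ≠ c' → star (x c) * x c' = 0 ∧ x c * star (x c') = 0) →
    (∀ c ∈ S, ‖x c‖ ≤ B) → ‖∑ c ∈ S, x c‖ ^ 2 ^ n ≤ S.card * B ^ 2 ^ n := by
  induction n with
  | zero =>
    intro x B _ hB
    simpa using norm_sum_le_of_le S hB
  | succ n ih =>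
    intro x B h hB
    have hsq : star (∑ c ∈ S, x c) * ∑ c ∈ S, x c = ∑ c ∈ S, star (x c) * x c := by
      rw [star_sum, Finset.sum_mul]
      refine Finset.sum_congr rfl fun c hc => ?_
      rw [Finset.mul_sum]
      exact Finset.sum_eq_single_of_mem c hc fun c' hc' hne => (h c hc c' hc' hne.symm).1
    rw [pow_succ', pow_mul, pow_mul, pow_two ‖_‖, ← CStarRing.norm_star_mul_self, hsq]
    refine ih _ _ (fun c hc c' hc' hne => ?_) fun c hc => ?_
    · have : star (x c) * x c * (star (x c') * x c') = 0 := by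
        rw [mul_assoc, ← mul_assoc (x c), (h c hc c' hc' hne).2, zero_mul, mul_zero]
      simp [this]
    · rw [CStarRing.norm_star_mul_self, ← pow_two]
      exact pow_le_pow_left₀ (norm_nonneg _) (hB c hc) 2

/-- The norm of a sum of elements with orthogonal ranges and orthogonal supports. -/
theorem norm_sum_le_of_orthogonal {K : Type*} {S : Finset K} {x : K → A} {B : ℝ} (hB₀ : 0 ≤ B)
    (h : ∀ c ∈ S, ∀ c' ∈ S, c ≠ c' → star (x c) * x c' = 0 ∧ x c * star (x c') = 0)
    (hB : ∀ c ∈ S, ‖x c‖ ≤ B) : ‖∑ c ∈ S, x c‖ ≤ B := by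
  by_contra! hlt
  have key := fun n => norm_sum_pow_le_of_orthogonal S n x B h hB
  rcases hB₀.eq_or_lt with rfl | hpos
  · have := key 0
    simp only [pow_zero, pow_one, mul_zero] at this
    exact absurd this (not_le.2 hlt)
  · obtain ⟨n, hn⟩ := pow_unbounded_of_one_lt (S.card : ℝ) ((one_lt_div hpos).2 hlt)
    have h₁ := hn.trans_le
      (pow_le_pow_right₀ ((one_lt_div hpos).2 hlt).le (Nat.lt_two_pow_self (n := n)).le)
    rw [div_pow, lt_div_iff₀ (by positivity)] at h₁
    exact absurd (key n) (not_le.2 h₁)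

end OrthogonalSum

/-- A system of matrix units indexed by `J`, some of which may vanish. -/
structure IsMatrixUnits {A : Type*} [Ring A] [StarRing A] {J : Type*} (f : J → J → A) : Prop where
  star_eq : ∀ i j, star (f i j) = f j i
  mul_eq : ∀ i j l, f i j * f j l = f i l
  mul_eq_zero : ∀ i j k l, j ≠ k → f i j * f k l = 0

namespace IsMatrixUnits

variable {A : Type*} [NormedRing A] [StarRing A] [NormedAlgebra ℂ A] {J : Type*} [Fintype J]
  {f e : J → J → A}

theorem mul_sum_mul (hf : IsMatrixUnits f) (M : J → J → ℂ) (k l : J) :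
    f k k * (∑ i, ∑ j, M i j • f i j) * f l l = M k l • f k l := by
  rw [Finset.mul_sum, Finset.sum_mul, Finset.sum_eq_single k, Finset.mul_sum, Finset.sum_mul,
    Finset.sum_eq_single l]
  · rw [mul_smul_comm, smul_mul_assoc, hf.mul_eq, hf.mul_eq]
  · intro j _ hj
    rw [mul_smul_comm, smul_mul_assoc, hf.mul_eq, hf.mul_eq_zero _ _ _ _ hj, smul_zero]
  · simp
  · intro i _ hi
    simp only [Finset.mul_sum, mul_smul_comm, hf.mul_eq_zero _ _ _ _ hi.symm, smul_zero,
      Finset.sum_const_zero, zero_mul]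
  · simp

/-- The representation of the matrix algebra given by a system of matrix units. -/
noncomputable def hom [StarModule ℂ A] (hf : IsMatrixUnits f) : CStarMatrix J J ℂ →⋆ₙₐ[ℂ] A where
  toFun M := ∑ i, ∑ j, M i j • f i j
  map_smul' c M := by
    simp only [CStarMatrix.smul_apply, Finset.smul_sum, smul_assoc, MonoidHom.id_apply]
  map_zero' := by simp
  map_add' M N := by
    simp only [CStarMatrix.add_apply, add_smul, Finset.sum_add_distrib]
  map_mul' M N := by
    simp only [CStarMatrix.mul_apply, Finset.sum_smul, Finset.sum_mul]
    refine Finset.sum_congr rfl fun i _ => ?_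
    rw [Finset.sum_comm]
    refine Finset.sum_congr rfl fun j _ => ?_
    rw [eq_comm, Finset.mul_sum, Finset.sum_eq_single j]
    · simp only [Finset.mul_sum, smul_mul_smul_comm, hf.mul_eq]
    · intro k _ hk
      simp only [Finset.mul_sum, smul_mul_smul_comm, hf.mul_eq_zero _ _ _ _ hk.symm, smul_zero,
        Finset.sum_const_zero]
    · simp
  map_star' M := by
    simp only [CStarMatrix.star_apply, star_sum, star_smul, hf.star_eq]
    rw [Finset.sum_comm]

theorem hom_apply [StarModule ℂ A] (hf : IsMatrixUnits f) (M : CStarMatrix J J ℂ) :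
    hf.hom M = ∑ i, ∑ j, M i j • f i j := rfl

theorem hom_injective [StarModule ℂ A] (hf : IsMatrixUnits f) (h : ∀ i, f i i ≠ 0) :
    Function.Injective hf.hom := by
  rw [injective_iff_map_eq_zero]
  intro M hM
  ext k l
  have h₁ := hf.mul_sum_mul M k l
  rw [hf.hom_apply] at hM
  rw [hM, mul_zero, zero_mul, eq_comm, smul_eq_zero] at h₁
  refine h₁.resolve_right fun h₂ => h k ?_
  rw [← hf.mul_eq k l k, h₂, zero_mul]

open scoped ComplexOrder in
theorem norm_sum_le [CStarRing A] [StarModule ℂ A] [CompleteSpace A] (he : IsMatrixUnits e)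
    (hf : IsMatrixUnits f) (h : ∀ i, f i i ≠ 0) (M : J → J → ℂ) :
    ‖∑ i, ∑ j, M i j • e i j‖ ≤ ‖∑ i, ∑ j, M i j • f i j‖ := by
  let _ : CStarAlgebra A := {}
  have h₁ := NonUnitalStarAlgHom.norm_apply_le he.hom (CStarMatrix.ofMatrix (Matrix.of M))
  rwa [← NonUnitalStarAlgHom.norm_map hf.hom (hf.hom_injective h)] at h₁

end IsMatrixUnits

namespace KGraph

variable {k : ℕ} {Λ : KGraph k}

/-- The coefficient of `t rho * gap * star (t sig)` in `∑ p ∈ S, a p • (t p.1 * star (t p.2))`. -/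
noncomputable def coeff (S : Finset (Λ.Path × Λ.Path)) (a : Λ.Path × Λ.Path → ℂ)
    (rho sig : Λ.Path) : ℂ :=
  ∑ p ∈ S, if SameTail p.1 p.2 rho sig then a p else 0

theorem coeff_smul (S : Finset (Λ.Path × Λ.Path)) (a : Λ.Path × Λ.Path → ℂ)
    (rho sig : Λ.Path) {A : Type*} [AddCommGroup A] [Module ℂ A] (x : A) :
    coeff S a rho sig • x = ∑ p ∈ S, a p • if SameTail p.1 p.2 rho sig then x else 0 := by
  rw [coeff, Finset.sum_smul]
  refine Finset.sum_congr rfl fun p _ => ?_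
  split_ifs <;> simp

section

variable {A : Type*} [Ring A] [StarRing A] {t : Λ.Path → A} {G : Finset Λ.Path}

theorem TCKFamily.isMatrixUnits (ht : Λ.TCKFamily t) {C : Finset Λ.Path} {v : Λ.Path}
    (hd : ∀ rho ∈ C, ∀ sig ∈ C, Λ.d rho = Λ.d sig) (hs : ∀ rho ∈ C, Λ.s rho = v) {q : A}
    (hq : IsStarProjection q) (hc : Commute (t v) q) :
    IsMatrixUnits fun i j : C => t i * q * star (t j) where
  star_eq i j := by simp [mul_assoc, hq.isSelfAdjoint.star_eq]
  mul_eq i j l := by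
    have h : t i * q * star (t j) * (t j * q * star (t l)) =
        t i * (q * (star (t j) * t j) * q) * star (t l) := by
      simp only [mul_assoc]
    rw [h, ht.star_mul_self, hs _ j.2, ← hc.eq, mul_assoc (t v), hq.isIdempotentElem.eq, ← hs _ i.2,
      ← mul_assoc (t i), ht.mul_s]
  mul_eq_zero i j n l hne := by
    have h : t i * q * star (t j) * (t n * q * star (t l)) =
        t i * (q * (star (t j) * t n) * q) * star (t l) := by
      simp only [mul_assoc]
    rw [h, ht.star_mul_eq_zero_of_d_eq (hd _ j.2 _ n.2) fun e => hne (Subtype.ext e)]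
    simp

theorem TCKFamily.isStarProjection_sum (ht : Λ.TCKFamily t) {C : Finset Λ.Path} {v : Λ.Path}
    (hd : ∀ rho ∈ C, ∀ sig ∈ C, Λ.d rho = Λ.d sig) (hs : ∀ rho ∈ C, Λ.s rho = v) {q : A}
    (hq : IsStarProjection q) (hc : Commute (t v) q) :
    IsStarProjection (∑ rho ∈ C, t rho * q * star (t rho)) := by
  have hu := ht.isMatrixUnits hd hs hq hc
  rw [← Finset.sum_coe_sort C fun rho => t rho * q * star (t rho)]
  constructor
  · rw [IsIdempotentElem, Finset.sum_mul]
    refine Finset.sum_congr rfl fun i _ => ?_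
    rw [Finset.mul_sum, Finset.sum_eq_single i]
    · exact hu.mul_eq i i i
    · exact fun j _ hj => hu.mul_eq_zero i i j j hj.symm
    · simp
  · rw [isSelfAdjoint_iff, star_sum]
    exact Finset.sum_congr rfl fun i _ => hu.star_eq i i

end

section

open TCKFamily

variable {A : Type*} [NormedRing A] [StarRing A] [CStarRing A] [NormedAlgebra ℂ A]
  [CompleteSpace A] [StarModule ℂ A] {t : Λ.Path → A} {𝓔 : Set (Set Λ.Path)}
  {G : Finset Λ.Path}

theorem RCKFamily.norm_class_le (ht : Λ.RCKFamily 𝓔 t) (hΛ : Λ.FinitelyAligned)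
    (hC : Λ.CondC 𝓔) (hnz : ∀ v, Λ.IsVertex v → t v ≠ 0)
    (hfe : ∀ F v, Λ.FEat v F → F ∉ 𝓔 → Λ.gapProd t v F ≠ 0)
    (hG : IsClosedSet (G : Set Λ.Path)) {S : Finset (Λ.Path × Λ.Path)}
    (hS : ∀ p ∈ S, p.1 ∈ G ∧ p.2 ∈ G) (a : Λ.Path × Λ.Path → ℂ) {C : Finset Λ.Path}
    (hCG : C ⊆ G) {v : Λ.Path} (hd : ∀ rho ∈ C, ∀ sig ∈ C, Λ.d rho = Λ.d sig)
    (hs : ∀ rho ∈ C, Λ.s rho = v) :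
    ‖∑ rho ∈ C, ∑ sig ∈ C, coeff S a rho sig • (t rho * gap t G sig * star (t sig))‖ ≤
      ‖∑ p ∈ S, a p • (t p.1 * star (t p.2))‖ := by
  rcases C.eq_empty_or_nonempty with rfl | ⟨rho₀, h₀⟩
  · simp
  have htails : ∀ rho ∈ C, tails (G : Set Λ.Path) rho = tails (G : Set Λ.Path) rho₀ :=
    fun rho hr => tails_congr hG (hCG hr) (hCG h₀) (hd _ hr _ h₀) ((hs _ hr).trans (hs _ h₀).symm)
  have hgap : ∀ rho ∈ C, gap t G rho = gap t G rho₀ := fun rho hr => by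
    rw [gap, gap, htails _ hr, hs _ hr, hs _ h₀]
  have hv : Λ.IsVertex v := hs _ h₀ ▸ isVertex_s rho₀
  have hsum : ∑ rho ∈ C, ∑ sig ∈ C, coeff S a rho sig • (t rho * gap t G sig * star (t sig)) =
      ∑ rho ∈ C, ∑ sig ∈ C, coeff S a rho sig • (t rho * gap t G rho₀ * star (t sig)) :=
    Finset.sum_congr rfl fun rho hr => Finset.sum_congr rfl fun sig hs => by rw [hgap _ hs]
  rw [hsum]
  by_cases hg : gap t G rho₀ = 0
  · simp [hg]
  let P : Set (Λ.Path × Λ.Path) := {p | (∃ rho ∈ C, ∃ lam, Λ.s lam = Λ.r p.1 ∧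
    Λ.comp lam p.1 = rho) ∧ (∃ sig ∈ C, ∃ mu, Λ.s mu = Λ.r p.2 ∧ Λ.comp mu p.2 = sig) ∧
    p.1 ≠ p.2}
  have hP : P.Finite := by
    have hfin : (⋃ rho ∈ C, {alpha | ∃ mu, Λ.s mu = Λ.r alpha ∧ Λ.comp mu alpha = rho}).Finite :=
      C.finite_toSet.biUnion fun rho _ => finite_final_segments rho
    refine (hfin.prod hfin).subset fun p hp => ?_
    simp only [Set.mem_prod, Set.mem_iUnion, exists_prop]
    exact ⟨hp.1, hp.2.1⟩
  have hPv : ∀ p ∈ P, p.1 ≠ p.2 ∧ Λ.s p.1 = v ∧ Λ.s p.2 = v := by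
    rintro ⟨beta, gamma⟩ ⟨⟨rho, hr, lam, h₁, rfl⟩, ⟨sig, hsig, mu, h₂, rfl⟩, hne⟩
    exact ⟨hne, (Λ.s_comp _ _ h₁).symm.trans (hs _ hr), (Λ.s_comp _ _ h₂).symm.trans (hs _ hsig)⟩
  obtain ⟨q, hq, hq₀, hqT, hqv, hqP⟩ := ht.exists_projection hΛ hC hnz hfe hv
    (finite_tails G.finite_toSet rho₀)
    (fun nu h => ⟨(r_of_mem_tails h).trans (hs _ h₀), h.2.1⟩) (hs _ h₀ ▸ hg) hP hPv
  have hc : Commute (t v) q := by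
    have := congrArg star hqv
    rw [star_mul, ht.1.star_vertex hv, hq.isSelfAdjoint.star_eq] at this
    exact this.trans hqv.symm
  have hY := ht.1.isStarProjection_sum hd hs hq hc
  set Y := ∑ rho ∈ C, t rho * q * star (t rho) with hYdef
  have hcomp : Y * (∑ p ∈ S, a p • (t p.1 * star (t p.2))) * Y =
      ∑ rho ∈ C, ∑ sig ∈ C, coeff S a rho sig • (t rho * q * star (t sig)) := by
    simp only [coeff_smul]
    rw [hYdef, Finset.sum_mul_sum, Finset.sum_mul]
    refine Finset.sum_congr rfl fun rho hr => ?_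
    rw [Finset.mul_sum]
    refine Finset.sum_congr rfl fun sig hsig => ?_
    rw [Finset.sum_mul]
    refine Finset.sum_congr rfl fun p hp => ?_
    rw [mul_smul_comm, smul_mul_assoc, ht.1.compress hΛ hG (hS p hp).1 (hS p hp).2 (hCG hr)
      (hCG hsig) (hs _ hr) hq (htails _ hr ▸ hqT) (htails _ hsig ▸ hqT) hqv]
    intro beta gamma h₁ h₂ h₃ h₄ hne
    exact hqP (beta, gamma) ⟨⟨rho, hr, p.1, h₁, h₃⟩, ⟨sig, hsig, p.2, h₂, h₄⟩, hne⟩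
  calc _ ≤ ‖∑ rho ∈ C, ∑ sig ∈ C, coeff S a rho sig • (t rho * q * star (t sig))‖ := by
        have hgc : Commute (t v) (gap t G rho₀) := hs _ h₀ ▸ ht.1.gap_commute hΛ rho₀
        have := (ht.1.isMatrixUnits hd hs (ht.1.isStarProjection_gap hΛ rho₀) hgc)
          |>.norm_sum_le (ht.1.isMatrixUnits hd hs hq hc) (fun i h => hq₀ ?_)
          fun i j => coeff S a i j
        · simpa only [← Finset.sum_coe_sort C] using this
        · have h₁ := congrArg (fun x => star (t i) * x * t i) h
          simp only [mul_assoc, mul_zero, zero_mul, ht.1.star_mul_self, hs _ i.2] at h₁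
          rwa [← mul_assoc, ht.1.star_mul_self, hs _ i.2, hqv, hc.eq, hqv] at h₁
    _ ≤ _ := by
        rw [← hcomp]
        refine (norm_mul_le _ _).trans ?_
        refine (mul_le_of_le_one_right (norm_nonneg _) hY.norm_le).trans ?_
        refine (norm_mul_le _ _).trans ?_
        exact mul_le_of_le_one_left (norm_nonneg _) hY.norm_le

theorem RCKFamily.norm_sum_filter_le (ht : Λ.RCKFamily 𝓔 t) (hΛ : Λ.FinitelyAligned)
    (hC : Λ.CondC 𝓔) (hnz : ∀ v, Λ.IsVertex v → t v ≠ 0)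
    (hfe : ∀ F v, Λ.FEat v F → F ∉ 𝓔 → Λ.gapProd t v F ≠ 0)
    {S : Finset (Λ.Path × Λ.Path)} (hS : ∀ p ∈ S, Λ.s p.1 = Λ.s p.2)
    (a : Λ.Path × Λ.Path → ℂ) :
    ‖∑ p ∈ S with Λ.d p.1 = Λ.d p.2, a p • (t p.1 * star (t p.2))‖ ≤
      ‖∑ p ∈ S, a p • (t p.1 * star (t p.2))‖ := by
  obtain ⟨G', hfin, hSG', hG'⟩ := exists_finite_closed hΛ
    ((S.image Prod.fst ∪ S.image Prod.snd).finite_toSet)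
  obtain ⟨G, rfl⟩ := hfin.exists_finset_coe
  have hSG : ∀ p ∈ S, p.1 ∈ G ∧ p.2 ∈ G := fun p hp =>
    ⟨hSG' (Finset.mem_coe.2 (Finset.mem_union_left _ (Finset.mem_image_of_mem _ hp))),
      hSG' (Finset.mem_coe.2 (Finset.mem_union_right _ (Finset.mem_image_of_mem _ hp)))⟩
  let cls : Λ.Path → (Fin k → ℕ) × Λ.Path := fun rho => (Λ.d rho, Λ.s rho)
  let e : Λ.Path → Λ.Path → A := fun rho sig => t rho * gap t G sig * star (t sig)
  have hexp : ∑ p ∈ S with Λ.d p.1 = Λ.d p.2, a p • (t p.1 * star (t p.2)) =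
      ∑ rho ∈ G, ∑ sig ∈ G with cls sig = cls rho, coeff S a rho sig • e rho sig := by
    have h₁ : ∀ rho sig, ∑ p ∈ S with Λ.d p.1 = Λ.d p.2,
        (a p • if SameTail p.1 p.2 rho sig then e rho sig else 0) =
        if cls sig = cls rho then coeff S a rho sig • e rho sig else 0 := by
      intro rho sig
      rw [coeff_smul, Finset.sum_filter, Finset.ite_sum_zero]
      refine Finset.sum_congr rfl fun p hp => ?_
      by_cases h : SameTail p.1 p.2 rho sig
      · have : Λ.d p.1 = Λ.d p.2 ↔ cls sig = cls rho := by
          rw [← h.d_eq_iff, Prod.mk.injEq, and_iff_left h.s_eq.symm, eq_comm]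
        simp only [this]
      · simp [h]
    calc _ = ∑ p ∈ S with Λ.d p.1 = Λ.d p.2, ∑ rho ∈ G, ∑ sig ∈ G,
          a p • if SameTail p.1 p.2 rho sig then e rho sig else 0 := by
          refine Finset.sum_congr rfl fun p hp => ?_
          obtain ⟨hp, hd⟩ := Finset.mem_filter.1 hp
          rw [ht.1.mul_star_eq_sum hΛ hG' (hSG p hp).1 (hSG p hp).2 hd (hS p hp)]
          simp only [Finset.smul_sum, e]
      _ = _ := by
          rw [Finset.sum_comm]
          refine Finset.sum_congr rfl fun rho _ => ?_
          rw [Finset.sum_comm, Finset.sum_filter]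
          exact Finset.sum_congr rfl fun sig _ => h₁ rho sig
  let x : (Fin k → ℕ) × Λ.Path → A := fun c =>
    ∑ rho ∈ G with cls rho = c, ∑ sig ∈ G with cls sig = c, coeff S a rho sig • e rho sig
  have hx : ∑ rho ∈ G, ∑ sig ∈ G with cls sig = cls rho, coeff S a rho sig • e rho sig =
      ∑ c ∈ G.image cls, x c := by
    rw [← Finset.sum_fiberwise_of_maps_to (g := cls) (t := G.image cls)
      fun rho hr => Finset.mem_image_of_mem _ hr]
    refine Finset.sum_congr rfl fun c _ => Finset.sum_congr rfl fun rho hr => ?_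
    rw [(Finset.mem_filter.1 hr).2]
  have hstar : ∀ rho sig, star (e rho sig) = t sig * gap t G sig * star (t rho) := fun rho sig => by
    simp only [e, star_mul, star_star, (ht.1.isStarProjection_gap hΛ sig).isSelfAdjoint.star_eq,
      mul_assoc]
  have hswap : ∀ rho ∈ G, ∀ sig ∈ G, cls rho = cls sig → gap t G rho = gap t G sig := by
    intro rho hr sig hs h
    rw [gap, gap, tails_congr hG' hr hs (congrArg Prod.fst h) (congrArg Prod.snd h),
      show Λ.s rho = Λ.s sig from congrArg Prod.snd h]
  have hzero : ∀ rho ∈ G, ∀ sig ∈ G, rho ≠ sig → ∀ y z,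
      y * gap t G rho * star (t rho) * (t sig * gap t G sig * z) = 0 := by
    intro rho hr sig hs hne y z
    have h : y * gap t G rho * star (t rho) * (t sig * gap t G sig * z) =
        y * (gap t G rho * (star (t rho) * t sig) * gap t G sig) * z := by
      simp only [mul_assoc]
    rw [h, ht.1.mul_star_mul_mul_eq_zero hΛ hG' hr hs hne (fun _ h => ht.1.gap_mul hΛ h)
      (fun _ h => ht.1.star_mul_gap hΛ h), mul_zero, zero_mul]
  rw [hexp, hx]
  refine norm_sum_le_of_orthogonal (norm_nonneg _) (fun c _ c' _ hne => ?_) fun c _ => ?_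
  · have hne' : ∀ {rho sig}, rho ∈ G.filter (cls · = c) → sig ∈ G.filter (cls · = c') →
        rho ≠ sig := by
      rintro rho _ h₁ h₂ rfl
      exact hne ((Finset.mem_filter.1 h₁).2.symm.trans (Finset.mem_filter.1 h₂).2)
    simp only [x, star_sum, star_smul, Finset.sum_mul, Finset.mul_sum, smul_mul_smul_comm]
    constructor <;>
    refine Finset.sum_eq_zero fun _ h₁ => Finset.sum_eq_zero fun _ h₂ =>
      Finset.sum_eq_zero fun _ h₃ => Finset.sum_eq_zero fun _ h₄ => smul_eq_zero_of_right _ ?_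
    all_goals
      have hne₁ := hne' h₃ h₁
      have hne₂ := hne' h₄ h₂
      obtain ⟨h₁, h₁'⟩ := Finset.mem_filter.1 h₁
      obtain ⟨h₂, h₂'⟩ := Finset.mem_filter.1 h₂
      obtain ⟨h₃, h₃'⟩ := Finset.mem_filter.1 h₃
      obtain ⟨h₄, h₄'⟩ := Finset.mem_filter.1 h₄
      rw [hstar]
    · simp only [e]
      rw [hswap _ h₄ _ h₃ (h₄'.trans h₃'.symm), hswap _ h₂ _ h₁ (h₂'.trans h₁'.symm)]
      exact hzero _ h₃ _ h₁ hne₁ _ _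
    · exact hzero _ h₄ _ h₂ hne₂ _ _
  · refine ht.norm_class_le hΛ hC hnz hfe hG' hSG a (v := c.2) (Finset.filter_subset _ _)
      (fun rho hr sig hs => ?_) fun rho hr => ?_
    · exact congrArg Prod.fst
        ((Finset.mem_filter.1 hr).2.trans (Finset.mem_filter.1 hs).2.symm)
    · exact congrArg Prod.snd (Finset.mem_filter.1 hr).2

end

end KGraph

/-- Lemma 6.6: under condition (C), for any relative Cuntz-Krieger
`(Λ;𝓔)`-family with nonzero vertex projections and nonzero gap products outside `𝓔`,
and any finitely supported `a` on pairs of paths with common source,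
`‖Σ_{d(λ)=d(μ)} a(λ,μ) t_λ t_μ*‖ ≤ ‖Σ_{(λ,μ)} a(λ,μ) t_λ t_μ*‖`. -/
theorem statement17 {k : ℕ} (Λ : KGraph k) (hΛ : Λ.FinitelyAligned)
    (𝓔 : Set (Set Λ.Path)) (h𝓔 : Λ.Satiated 𝓔) (hC : Λ.CondC 𝓔)
    {A : Type*} [NormedRing A] [StarRing A] [CStarRing A] [NormedAlgebra ℂ A]
    [CompleteSpace A] [StarModule ℂ A]
    (t : Λ.Path → A) (ht : Λ.RCKFamily 𝓔 t)
    (hnz : ∀ v, Λ.IsVertex v → t v ≠ 0)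
    (hfe : ∀ F v, Λ.FEat v F → F ∉ 𝓔 → Λ.gapProd t v F ≠ 0)
    (a : Λ.Path × Λ.Path → ℂ) (hafin : {p | a p ≠ 0}.Finite)
    (has : ∀ p : Λ.Path × Λ.Path, a p ≠ 0 → Λ.s p.1 = Λ.s p.2) :
    ‖∑ᶠ p ∈ {p : Λ.Path × Λ.Path | Λ.d p.1 = Λ.d p.2}, a p • (t p.1 * star (t p.2))‖ ≤
      ‖∑ᶠ p : Λ.Path × Λ.Path, a p • (t p.1 * star (t p.2))‖ := by
  have hsupp : ∀ p : Λ.Path × Λ.Path, a p • (t p.1 * star (t p.2)) ≠ 0 → a p ≠ 0 := fun p h h₀ =>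
    h (by rw [h₀, zero_smul])
  rw [finsum_mem_eq_sum_of_inter_support_eq (t := {p ∈ hafin.toFinset | Λ.d p.1 = Λ.d p.2}),
    finsum_eq_sum_of_support_subset (s := hafin.toFinset)]
  · exact ht.norm_sum_filter_le hΛ hC hnz hfe (fun p hp => has p (hafin.mem_toFinset.1 hp)) a
  · intro p hp
    simpa using hsupp p hp
  · ext p
    simp only [Set.mem_inter_iff, Set.mem_ofPred_eq, Function.mem_support, Finset.coe_filter,
      Set.Finite.mem_toFinset]
    exact ⟨fun h => ⟨⟨hsupp p h.2, h.1⟩, h.2⟩, fun h => ⟨h.1.2, h.2⟩⟩
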